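/- arXiv:2504.07663 — 3 statements merged into one kernel-verified Lean document; each statement's English description precedes it below -/
import Mathlib

section
/- Let A, B ⊆ Fin n with |A| < k < |B|, assume cost(A) = h(|A|) and cost(B) = h(|B|), and set λ = (cost(A) − cost(B)) / (|B| − |A|). Assume that for every X ⊆ Fin n with |A| < |X| < |B| and cost(X) = h(|X|) one has cost(X) + λ · |X| ≥ cost(A) + λ · |A|. Then (A, B) is an optimal pair, i.e. the minimum of obj over P(k) equals f_{A,B}(k). -/
open Finset

noncomputable section

/-- Cost of the assignment `π` (customer `j` is assigned to supplier `π j`)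
when the suppliers in `A` are upgraded. -/
def assignCost {n : ℕ} (b c d : Fin n → ℝ) (A : Finset (Fin n))
    (π : Equiv.Perm (Fin n)) : ℝ :=
  ∑ j, (if π j ∈ A then b (π j) else c (π j)) * d j

/-- `cost A` : minimum assignment cost when upgrading the suppliers in `A`. -/
def cost {n : ℕ} (b c d : Fin n → ℝ) (A : Finset (Fin n)) : ℝ :=
  Finset.univ.inf' Finset.univ_nonempty (assignCost b c d A)

/-- The LP feasible region `P(k)`. -/
def Pk (n k : ℕ) : Set ((Fin n → Fin n → ℝ) × (Fin n → Fin n → ℝ)) :=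
  {p | (∀ i j, 0 ≤ p.1 i j) ∧ (∀ i j, 0 ≤ p.2 i j) ∧
    (∀ j, ∑ i, (p.1 i j + p.2 i j) = 1) ∧
    (∀ i, ∑ j, (p.1 i j + p.2 i j) = 1) ∧
    (∑ i, ∑ j, p.1 i j) ≤ (k : ℝ)}

/-- The LP objective. -/
def obj {n : ℕ} (b c d : Fin n → ℝ)
    (p : (Fin n → Fin n → ℝ) × (Fin n → Fin n → ℝ)) : ℝ :=
  ∑ i, ∑ j, (b i * p.1 i j + c i * p.2 i j) * d j

/-- A point is integral if all of its entries lie in `{0, 1}`. -/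
def Integral {n : ℕ} (p : (Fin n → Fin n → ℝ) × (Fin n → Fin n → ℝ)) : Prop :=
  (∀ i j, p.1 i j = 0 ∨ p.1 i j = 1) ∧ (∀ i j, p.2 i j = 0 ∨ p.2 i j = 1)

/-- `f_{A,B}(k)`. -/
def fpair {n : ℕ} (b c d : Fin n → ℝ) (k : ℕ) (A B : Finset (Fin n)) : ℝ :=
  (((B.card : ℝ) - k) * cost b c d A + ((k : ℝ) - A.card) * cost b c d B) /
    ((B.card : ℝ) - A.card)

/-- `(A, B)` is an optimal pair. -/
def OptimalPair {n : ℕ} (b c d : Fin n → ℝ) (k : ℕ) (A B : Finset (Fin n)) : Prop :=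
  A.card < k ∧ k < B.card ∧ IsLeast (obj b c d '' Pk n k) (fpair b c d k A B)

/-- `X` is simple: some optimal assignment for upgrading `X` assigns every
upgraded supplier to a customer with positive demand. -/
def SimpleSet {n : ℕ} (b c d : Fin n → ℝ) (X : Finset (Fin n)) : Prop :=
  ∃ π : Equiv.Perm (Fin n), assignCost b c d X π = cost b c d X ∧
    ∀ j, π j ∈ X → 0 < d j

/-- `(A, B)` is clean. -/
def Clean {n : ℕ} (b c : Fin n → ℝ) (A B : Finset (Fin n)) : Prop :=
  ∀ i ∈ symmDiff A B, ∀ i' ∈ symmDiff A B, ¬ (b i < b i' ∧ c i' < c i)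

/-- `(A', B')` is a redistribution of `(A, B)` : the elements of `A ∆ B` are
enumerated `e 0, e 1, …` with `b` and `c` both nondecreasing along the
enumeration, the elements with odd (0-based) index go to `A'` and those with
even (0-based) index go to `B'` (on top of `A ∩ B`). -/
def Redistribution {n : ℕ} (b c : Fin n → ℝ) (A B A' B' : Finset (Fin n)) : Prop :=
  ∃ (ℓ : ℕ) (e : Fin ℓ → Fin n), Function.Injective e ∧
    Finset.image e Finset.univ = symmDiff A B ∧
    Monotone (b ∘ e) ∧ Monotone (c ∘ e) ∧
    A' = (A ∩ B) ∪
      Finset.image e ((Finset.univ : Finset (Fin ℓ)).filter (fun s => (s : ℕ) % 2 = 1)) ∧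
    B' = (A ∩ B) ∪
      Finset.image e ((Finset.univ : Finset (Fin ℓ)).filter (fun s => (s : ℕ) % 2 = 0))

/-- The 0/1 point of the LP corresponding to assignment `π` with upgraded set `A`. -/
def chi {n : ℕ} (π : Equiv.Perm (Fin n)) (A : Finset (Fin n)) :
    (Fin n → Fin n → ℝ) × (Fin n → Fin n → ℝ) :=
  (fun i j => if π j = i ∧ i ∈ A then 1 else 0,
   fun i j => if π j = i ∧ i ∉ A then 1 else 0)

/-- `hval k'` : minimum of `cost X` over all `X` of cardinality `k'`. -/
def hval {n : ℕ} (b c d : Fin n → ℝ) (k' : ℕ) : ℝ :=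
  sInf {v | ∃ X : Finset (Fin n), X.card = k' ∧ cost b c d X = v}

end

/-! ### Rearrangement of two layered cost vectors -/

lemma lowerSet_mem_iff_lt_card {m : ℕ} (s : Finset (Fin m))
    (hs : ∀ i j : Fin m, i ≤ j → j ∈ s → i ∈ s) (t : Fin m) : t ∈ s ↔ (t : ℕ) < s.card := by
  constructor
  · intro ht
    have hsub : Finset.Iic t ⊆ s := fun i hi => hs i t (Finset.mem_Iic.1 hi) ht
    have := Finset.card_le_card hsub
    rw [Fin.card_Iic] at this
    omega
  · intro ht
    by_contra hts
    have hsub : s ⊆ Finset.Iio t := fun i hi => by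
      rw [Finset.mem_Iio]
      by_contra h
      exact hts (hs t i (not_lt.1 h) hi)
    have := Finset.card_le_card hsub
    rw [Fin.card_Iio] at this
    omega

/-- The indicator of `θ < v`. -/
noncomputable def layer (θ v : ℝ) : ℝ := if θ < v then 1 else 0

lemma layer_eq_indicator (v : ℝ) :
    (fun θ => layer θ v) = (Set.Iio v).indicator (fun _ => (1 : ℝ)) := by
  funext θ
  simp [layer, Set.indicator_apply]

lemma intervalIntegrable_layer (M v : ℝ) :
    IntervalIntegrable (fun θ => layer θ v) MeasureTheory.volume 0 M := by
  rw [layer_eq_indicator, intervalIntegrable_iff]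
  exact (MeasureTheory.integrableOn_const (by simp)).indicator measurableSet_Iio

lemma integral_layer {M v : ℝ} (h0 : 0 ≤ v) (hM : v ≤ M) :
    ∫ θ in (0 : ℝ)..M, layer θ v = v := by
  rw [layer_eq_indicator, intervalIntegral.integral_of_le (h0.trans hM),
    MeasureTheory.integral_indicator measurableSet_Iio,
    MeasureTheory.Measure.restrict_restrict measurableSet_Iio]
  have : (Set.Iio v ∩ Set.Ioc 0 M) = Set.Ioo 0 v := by
    ext θ
    simp only [Set.mem_inter_iff, Set.mem_Iio, Set.mem_Ioc, Set.mem_Ioo]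
    constructor
    · rintro ⟨h1, h2, _⟩
      exact ⟨h2, h1⟩
    · rintro ⟨h1, h2⟩
      exact ⟨h2, h1, by linarith⟩
  rw [this]
  simp [h0]

lemma intervalIntegrable_sum_layer {n : ℕ} (d : Fin n → ℝ) (M : ℝ) (f : Fin n → ℝ) :
    IntervalIntegrable (fun θ => ∑ j, layer θ (f j) * d j) MeasureTheory.volume 0 M := by
  have := IntervalIntegrable.sum (μ := MeasureTheory.volume) (a := 0) (b := M) Finset.univ
    (f := fun j θ => layer θ (f j) * d j)
    (fun j _ => (intervalIntegrable_layer M (f j)).mul_const (d j))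
  simpa only [Finset.sum_fn] using this

lemma sum_mul_eq_integral_layer {n : ℕ} (d : Fin n → ℝ) {M : ℝ} (f : Fin n → ℝ)
    (h0 : ∀ i, 0 ≤ f i) (hM : ∀ i, f i ≤ M) :
    ∑ j, f j * d j = ∫ θ in (0 : ℝ)..M, ∑ j, layer θ (f j) * d j := by
  rw [intervalIntegral.integral_finsetSum]
  · refine Finset.sum_congr rfl fun j _ => ?_
    rw [intervalIntegral.integral_mul_const, integral_layer (h0 j) (hM j)]
  · exact fun j _ => (intervalIntegrable_layer M (f j)).mul_const (d j)

lemma sum_layer_mul_le_of_balanced {n : ℕ} (d f g f' g' : Fin n → ℝ) (θ τ : ℝ)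
    (hsum : ∑ j, layer θ (f j) + ∑ j, layer θ (g j) =
      ∑ j, layer θ (f' j) + ∑ j, layer θ (g' j))
    (hf : ∀ j, if θ < f' j then d j ≤ τ else τ ≤ d j)
    (hg : ∀ j, if θ < g' j then d j ≤ τ else τ ≤ d j) :
    ∑ j, layer θ (f' j) * d j + ∑ j, layer θ (g' j) * d j ≤
      ∑ j, layer θ (f j) * d j + ∑ j, layer θ (g j) * d j := by
  have key : ∀ u : Fin n → ℝ, ∑ j, layer θ (u j) * d j =
      τ * ∑ j, layer θ (u j) + ∑ j, layer θ (u j) * (d j - τ) := by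
    intro u
    rw [Finset.mul_sum, ← Finset.sum_add_distrib]
    exact Finset.sum_congr rfl fun j _ => by ring
  have hlow : ∀ u : Fin n → ℝ, ∑ j, min (d j - τ) 0 ≤ ∑ j, layer θ (u j) * (d j - τ) := by
    refine fun u => Finset.sum_le_sum fun j _ => ?_
    unfold layer
    split_ifs <;> simp
  have heq : ∀ u : Fin n → ℝ, (∀ j, if θ < u j then d j ≤ τ else τ ≤ d j) →
      ∑ j, layer θ (u j) * (d j - τ) = ∑ j, min (d j - τ) 0 := by
    refine fun u hu => Finset.sum_congr rfl fun j _ => ?_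
    have := hu j
    unfold layer
    split_ifs at this ⊢
    · rw [min_eq_left (by linarith), one_mul]
    · rw [min_eq_right (by linarith), zero_mul]
  rw [key f, key g, key f', key g', heq f' hf, heq g' hg]
  have h1 := hlow f
  have h2 := hlow g
  have h3 : τ * ∑ j, layer θ (f j) + τ * ∑ j, layer θ (g j) =
      τ * ∑ j, layer θ (f' j) + τ * ∑ j, layer θ (g' j) := by
    rw [← mul_add, ← mul_add, hsum]
  linarith

lemma exists_threshold {n : ℕ} (hn : 1 ≤ n) (d : Fin n → ℝ) (hd : Monotone d)
    (f g : Fin n → ℝ) (hf : Antitone f) (hg : Antitone g) (θ : ℝ)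
    (hbal : |∑ j, layer θ (f j) - ∑ j, layer θ (g j)| ≤ 1) :
    ∃ τ : ℝ, (∀ j, if θ < f j then d j ≤ τ else τ ≤ d j) ∧
      (∀ j, if θ < g j then d j ≤ τ else τ ≤ d j) := by
  have hmem : ∀ u : Fin n → ℝ, Antitone u → ∀ t : Fin n,
      θ < u t ↔ (t : ℕ) < (Finset.univ.filter fun j => θ < u j).card := by
    intro u hu t
    rw [← lowerSet_mem_iff_lt_card]
    · simp
    · intro i j hij hj
      simp only [Finset.mem_filter, Finset.mem_univ, true_and] at hj ⊢
      exact hj.trans_le (hu hij)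
  have hcard : ∀ u : Fin n → ℝ, ∑ j, layer θ (u j) =
      ((Finset.univ.filter fun j => θ < u j).card : ℝ) := by
    intro u
    simp [layer]
  have hF := hmem f hf
  have hG := hmem g hg
  rw [hcard, hcard] at hbal
  have hle : ∀ u : Fin n → ℝ, (Finset.univ.filter fun j => θ < u j).card ≤ n := fun u =>
    (Finset.card_le_univ _).trans (by simp)
  have hfn := hle f
  have hgn := hle g
  generalize (Finset.univ.filter fun j => θ < f j).card = p at *
  generalize (Finset.univ.filter fun j => θ < g j).card = q at *
  have h1 : p ≤ q + 1 := by
    have := (abs_le.1 hbal).2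
    have : (p : ℝ) ≤ q + 1 := by linarith
    exact_mod_cast this
  have h2 : q ≤ p + 1 := by
    have := (abs_le.1 hbal).1
    have : (q : ℝ) ≤ p + 1 := by linarith
    exact_mod_cast this
  refine ⟨d ⟨min (min p q) (n - 1), by omega⟩, fun j => ?_, fun j => ?_⟩
  · split_ifs with h
    · rw [hF] at h
      exact hd (Fin.le_def.2 (by simp only; omega))
    · rw [hF] at h
      exact hd (Fin.le_def.2 (by simp only; omega))
  · split_ifs with h
    · rw [hG] at h
      exact hd (Fin.le_def.2 (by simp only; omega))
    · rw [hG] at h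
      exact hd (Fin.le_def.2 (by simp only; omega))

/-- If two cost vectors `f', g'` have, at every level, the same total number of large entries as
`f, g` and this number is shared almost equally between `f'` and `g'`, then their total optimal
assignment cost is at most that of `f, g`. -/
lemma exists_perm_sum_le_of_balanced {n : ℕ} (hn : 1 ≤ n) (d f g f' g' : Fin n → ℝ) {M : ℝ}
    (hf : ∀ i, 0 ≤ f i ∧ f i ≤ M) (hg : ∀ i, 0 ≤ g i ∧ g i ≤ M)
    (hf' : ∀ i, 0 ≤ f' i ∧ f' i ≤ M) (hg' : ∀ i, 0 ≤ g' i ∧ g' i ≤ M)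
    (hsum : ∀ θ i, layer θ (f i) + layer θ (g i) = layer θ (f' i) + layer θ (g' i))
    (hbal : ∀ θ, |∑ i, layer θ (f' i) - ∑ i, layer θ (g' i)| ≤ 1) :
    ∃ π' ρ' : Equiv.Perm (Fin n), ∀ π ρ : Equiv.Perm (Fin n),
      ∑ j, f' (π' j) * d j + ∑ j, g' (ρ' j) * d j ≤
        ∑ j, f (π j) * d j + ∑ j, g (ρ j) * d j := by
  set σ := Tuple.sort d
  have hanti : ∀ u : Fin n → ℝ, Antitone (u ∘ Tuple.sort (fun i => -u i)) := by
    intro u i j hij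
    have := Tuple.monotone_sort (fun i => -u i) hij
    simpa using this
  refine ⟨σ.symm.trans (Tuple.sort fun i => -f' i), σ.symm.trans (Tuple.sort fun i => -g' i),
    fun π ρ => ?_⟩
  have hM : 0 ≤ M := (hf ⟨0, hn⟩).1.trans (hf ⟨0, hn⟩).2
  rw [sum_mul_eq_integral_layer d (fun j => f' _) (fun i => (hf' _).1) (fun i => (hf' _).2),
    sum_mul_eq_integral_layer d (fun j => g' _) (fun i => (hg' _).1) (fun i => (hg' _).2),
    sum_mul_eq_integral_layer d (fun j => f _) (fun i => (hf _).1) (fun i => (hf _).2),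
    sum_mul_eq_integral_layer d (fun j => g _) (fun i => (hg _).1) (fun i => (hg _).2),
    ← intervalIntegral.integral_add (intervalIntegrable_sum_layer d M _)
      (intervalIntegrable_sum_layer d M _),
    ← intervalIntegral.integral_add (intervalIntegrable_sum_layer d M _)
      (intervalIntegrable_sum_layer d M _)]
  refine intervalIntegral.integral_mono_on hM
    ((intervalIntegrable_sum_layer d M _).add (intervalIntegrable_sum_layer d M _))
    ((intervalIntegrable_sum_layer d M _).add (intervalIntegrable_sum_layer d M _))
    fun θ _ => ?_
  have hperm : ∀ (u : Fin n → ℝ) (κ : Equiv.Perm (Fin n)),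
      ∑ j, layer θ (u (κ j)) = ∑ j, layer θ (u j) := fun u κ =>
    Equiv.sum_comp κ fun j => layer θ (u j)
  obtain ⟨τ, h1, h2⟩ := exists_threshold hn (d ∘ σ) (Tuple.monotone_sort d) _ _
    (hanti f') (hanti g') θ (by
      simp only [Function.comp_apply]
      rw [hperm f', hperm g']
      exact hbal θ)
  refine sum_layer_mul_le_of_balanced d _ _ _ _ θ τ ?_ ?_ ?_
  · rw [hperm, hperm, hperm, hperm, ← Finset.sum_add_distrib, ← Finset.sum_add_distrib]
    exact Finset.sum_congr rfl fun i _ => hsum θ i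
  · intro j
    have h := h1 (σ.symm j)
    simp only [Function.comp_apply, Equiv.apply_symm_apply] at h
    exact h
  · intro j
    have h := h2 (σ.symm j)
    simp only [Function.comp_apply, Equiv.apply_symm_apply] at h
    exact h

/-! ### Basic facts on costs -/

section Cost

variable {n : ℕ} (b c d : Fin n → ℝ)

lemma cost_le_assignCost (A : Finset (Fin n)) (π : Equiv.Perm (Fin n)) :
    cost b c d A ≤ assignCost b c d A π :=
  Finset.inf'_le _ (Finset.mem_univ π)

lemma exists_assignCost_eq_cost (A : Finset (Fin n)) :
    ∃ π : Equiv.Perm (Fin n), assignCost b c d A π = cost b c d A := by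
  obtain ⟨π, -, h⟩ := Finset.exists_mem_eq_inf' Finset.univ_nonempty (assignCost b c d A)
  exact ⟨π, h.symm⟩

lemma cost_antitone (hbc : ∀ i, b i ≤ c i) (hd : ∀ j, 0 ≤ d j) {X Y : Finset (Fin n)}
    (h : X ⊆ Y) : cost b c d Y ≤ cost b c d X := by
  obtain ⟨π, hπ⟩ := exists_assignCost_eq_cost b c d X
  rw [← hπ]
  refine (cost_le_assignCost b c d Y π).trans (Finset.sum_le_sum fun j _ => ?_)
  refine mul_le_mul_of_nonneg_right ?_ (hd j)
  by_cases hX : π j ∈ X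
  · simp [hX, h hX]
  · by_cases hY : π j ∈ Y <;> simp [hX, hY, hbc]

lemma hval_le_cost (X : Finset (Fin n)) : hval b c d X.card ≤ cost b c d X := by
  refine csInf_le ?_ ⟨X, rfl, rfl⟩
  refine Set.Finite.bddBelow ((Set.finite_range (cost b c d)).subset ?_)
  rintro v ⟨Y, -, rfl⟩
  exact ⟨Y, rfl⟩

lemma exists_cost_eq_hval {m : ℕ} (hm : m ≤ n) :
    ∃ X : Finset (Fin n), X.card = m ∧ cost b c d X = hval b c d m := by
  have hne : {v | ∃ X : Finset (Fin n), X.card = m ∧ cost b c d X = v}.Nonempty := by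
    obtain ⟨X, -, hX⟩ := Finset.exists_subset_card_eq (s := (Finset.univ : Finset (Fin n)))
      (n := m) (by simpa using hm)
    exact ⟨_, X, hX, rfl⟩
  have hfin : {v | ∃ X : Finset (Fin n), X.card = m ∧ cost b c d X = v}.Finite := by
    refine (Set.finite_range (cost b c d)).subset ?_
    rintro v ⟨Y, -, rfl⟩
    exact ⟨Y, rfl⟩
  exact hne.csInf_mem hfin

/-! ### Redistribution along a clean symmetric difference -/

lemma sum_range_neg_one_pow_mem (m : ℕ) :
    0 ≤ ∑ s ∈ Finset.range m, (-1 : ℝ) ^ s ∧ ∑ s ∈ Finset.range m, (-1 : ℝ) ^ s ≤ 1 := by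
  rw [neg_one_geom_sum]
  split_ifs <;> norm_num

lemma alternating_sum_lowerSet_mem {m : ℕ} (p : Fin m → Prop) [DecidablePred p]
    (hp : ∀ s t : Fin m, s ≤ t → p t → p s) :
    0 ≤ ∑ s : Fin m, (if p s then (-1 : ℝ) ^ (s : ℕ) else 0) ∧
      ∑ s : Fin m, (if p s then (-1 : ℝ) ^ (s : ℕ) else 0) ≤ 1 := by
  have key := lowerSet_mem_iff_lt_card (Finset.univ.filter p) (by simpa using hp)
  have hle : (Finset.univ.filter p).card ≤ m := (Finset.card_le_univ _).trans (by simp)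
  have h : ∑ s : Fin m, (if p s then (-1 : ℝ) ^ (s : ℕ) else 0) =
      ∑ s ∈ Finset.range (Finset.univ.filter p).card, (-1 : ℝ) ^ s := by
    generalize (Finset.univ.filter p).card = q at *
    calc _ = ∑ s : Fin m, (fun s : ℕ => if s < q then (-1 : ℝ) ^ s else 0) s := by
          refine Finset.sum_congr rfl fun s _ => ?_
          have := key s
          simp only [Finset.mem_filter, Finset.mem_univ, true_and] at this
          simp only [this]
      _ = ∑ s ∈ Finset.range m, (if s < q then (-1 : ℝ) ^ s else 0) :=
          Fin.sum_univ_eq_sum_range (fun s : ℕ => if s < q then (-1 : ℝ) ^ s else 0) m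
      _ = ∑ s ∈ Finset.range q, (-1 : ℝ) ^ s := by
          rw [← Finset.sum_filter]
          congr 1
          ext s
          simp only [Finset.mem_filter, Finset.mem_range]
          omega
  rw [h]
  exact sum_range_neg_one_pow_mem _

variable {b c} in
lemma Clean.exists_redistribution {A B : Finset (Fin n)} (h : Clean b c A B) :
    ∃ A' B', Redistribution b c A B A' B' := by
  set S := symmDiff A B
  let f : Fin S.card → ℝ ×ₗ ℝ := fun s => toLex (b (S.equivFin.symm s), c (S.equivFin.symm s))
  let e : Fin S.card → Fin n := fun s => S.equivFin.symm (Tuple.sort f s)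
  have he : ∀ s, e s ∈ S := fun s => (S.equivFin.symm (Tuple.sort f s)).2
  have hmono : ∀ s t, s ≤ t → b (e s) < b (e t) ∨ b (e s) = b (e t) ∧ c (e s) ≤ c (e t) := by
    intro s t hst
    have := Tuple.monotone_sort f hst
    simpa [f, e, Prod.Lex.le_iff] using this
  refine ⟨_, _, S.card, e, ?_, ?_, ?_, ?_, rfl, rfl⟩
  · exact Subtype.val_injective.comp
      (S.equivFin.symm.injective.comp (Tuple.sort f).injective)
  · ext i
    simp only [Finset.mem_image, Finset.mem_univ, true_and]
    constructor
    · rintro ⟨s, rfl⟩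
      exact he s
    · intro hi
      exact ⟨(Tuple.sort f).symm (S.equivFin ⟨i, hi⟩), by simp [e]⟩
  · intro s t hst
    rcases hmono s t hst with h1 | h1
    · exact h1.le
    · exact h1.1.le
  · intro s t hst
    rcases hmono s t hst with h1 | h1
    · exact not_lt.1 fun h2 => h _ (he s) _ (he t) ⟨h1, h2⟩
    · exact h1.2

section Redistribution

variable {A B A' B' : Finset (Fin n)}

variable {b c} in
lemma Redistribution.union_inter (h : Redistribution b c A B A' B') (i : Fin n) :
    (i ∈ A' ∧ i ∈ B' ↔ i ∈ A ∧ i ∈ B) ∧ (i ∈ A' ∨ i ∈ B' ↔ i ∈ A ∨ i ∈ B) := by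
  obtain ⟨m, e, he, hS, -, -, rfl, rfl⟩ := h
  have hi : (∃ s, e s = i) ↔ (i ∈ A ∧ i ∉ B ∨ i ∈ B ∧ i ∉ A) := by
    rw [← Finset.mem_symmDiff, ← hS]
    simp
  simp only [Finset.mem_union, Finset.mem_inter, Finset.mem_image, Finset.mem_filter,
    Finset.mem_univ, true_and]
  by_cases hex : ∃ s, e s = i
  · obtain ⟨s, rfl⟩ := hex
    have h1 := hi.1 ⟨s, rfl⟩
    have h2 : ∀ r, (∃ t : Fin m, (t : ℕ) % 2 = r ∧ e t = e s) ↔ (s : ℕ) % 2 = r := fun r =>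
      ⟨fun ⟨t, ht, hts⟩ => he hts ▸ ht, fun hr => ⟨s, hr, rfl⟩⟩
    rw [h2, h2]
    rcases Nat.mod_two_eq_zero_or_one (s : ℕ) with h3 | h3 <;> rw [h3] <;> simp <;> tauto
  · have h1 := hi.not.1 hex
    have h2 : ∀ r, ¬ ∃ t : Fin m, (t : ℕ) % 2 = r ∧ e t = i := fun r ⟨t, _, ht⟩ => hex ⟨t, ht⟩
    simp only [h2, or_false]
    tauto

lemma ite_add_ite_eq_of_union_inter
    (h : ∀ i, (i ∈ A' ∧ i ∈ B' ↔ i ∈ A ∧ i ∈ B) ∧ (i ∈ A' ∨ i ∈ B' ↔ i ∈ A ∨ i ∈ B))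
    (i : Fin n) (u v : ℝ) (φ : ℝ → ℝ) :
    φ (if i ∈ A then u else v) + φ (if i ∈ B then u else v) =
      φ (if i ∈ A' then u else v) + φ (if i ∈ B' then u else v) := by
  obtain ⟨h1, h2⟩ := h i
  by_cases hA : i ∈ A <;> by_cases hB : i ∈ B <;> by_cases hA' : i ∈ A' <;>
    by_cases hB' : i ∈ B' <;> simp_all [add_comm]

lemma card_eq_sum_ite (X : Finset (Fin n)) : (X.card : ℝ) = ∑ i, (if i ∈ X then 1 else 0) := by
  simp

/-- The difference of two sums over all suppliers, as an alternating sum along the enumeration. -/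
lemma sum_ite_sub_sum_ite_of_redistribution {m : ℕ} {e : Fin m → Fin n}
    (he : Function.Injective e)
    (hS : Finset.image e Finset.univ = symmDiff A B) (u v : Fin n → ℝ) :
    ∑ i, (if i ∈ (A ∩ B) ∪
        Finset.image e (Finset.univ.filter fun s => (s : ℕ) % 2 = 0) then u i else v i) -
      ∑ i, (if i ∈ (A ∩ B) ∪
        Finset.image e (Finset.univ.filter fun s => (s : ℕ) % 2 = 1) then u i else v i) =
      ∑ s : Fin m, (-1 : ℝ) ^ (s : ℕ) * (u (e s) - v (e s)) := by
  rw [← Finset.sum_sub_distrib]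
  symm
  apply Fintype.sum_of_injective e he
  · intro i hi
    have h2 : ∀ r, ¬ ∃ t : Fin m, (t : ℕ) % 2 = r ∧ e t = i := fun r ⟨t, _, ht⟩ => hi ⟨t, ht⟩
    simp [h2]
  · intro s
    have h2 : ∀ r, (∃ t : Fin m, (t : ℕ) % 2 = r ∧ e t = e s) ↔ (s : ℕ) % 2 = r := fun r =>
      ⟨fun ⟨t, ht, hts⟩ => he hts ▸ ht, fun hr => ⟨s, hr, rfl⟩⟩
    have h1 : e s ∉ A ∩ B := by
      have : e s ∈ symmDiff A B := by
        rw [← hS]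
        exact Finset.mem_image_of_mem _ (Finset.mem_univ s)
      rw [Finset.mem_symmDiff] at this
      rw [Finset.mem_inter]
      tauto
    simp only [Finset.mem_union, Finset.mem_image, Finset.mem_filter,
      Finset.mem_univ, true_and, h1, false_or, h2]
    rcases Nat.mod_two_eq_zero_or_one (s : ℕ) with h3 | h3
    · rw [Even.neg_one_pow (Nat.even_iff.2 h3)]
      simp [h3]
    · rw [Odd.neg_one_pow (Nat.odd_iff.2 h3)]
      simp [h3]

variable {b c} in
lemma Redistribution.card (h : Redistribution b c A B A' B') :
    A'.card + B'.card = A.card + B.card ∧ A'.card ≤ B'.card ∧ B'.card ≤ A'.card + 1 := by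
  have hui := h.union_inter
  obtain ⟨m, e, he, hS, -, -, hA', hB'⟩ := h
  have h1 : (A'.card : ℝ) + B'.card = A.card + B.card := by
    simp only [card_eq_sum_ite, ← Finset.sum_add_distrib]
    exact Finset.sum_congr rfl fun i _ => (ite_add_ite_eq_of_union_inter hui i 1 0 id).symm
  have h2 := sum_ite_sub_sum_ite_of_redistribution he hS (fun _ => 1) (fun _ => 0)
  have h3 := alternating_sum_lowerSet_mem (m := m) (fun _ => True) (by simp)
  rw [← hA', ← hB', ← card_eq_sum_ite, ← card_eq_sum_ite] at h2
  simp only [sub_zero, mul_one] at h2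
  simp only [if_true, ← h2] at h3
  refine ⟨by exact_mod_cast h1, ?_, ?_⟩
  · have : (A'.card : ℝ) ≤ B'.card := by linarith [h3.1]
    exact_mod_cast this
  · have : (B'.card : ℝ) ≤ A'.card + 1 := by linarith [h3.2]
    exact_mod_cast this

variable {b c} in
lemma Redistribution.cost_add_cost_le (hn : 1 ≤ n) (hb : ∀ i, 0 ≤ b i) (hbc : ∀ i, b i ≤ c i)
    (h : Redistribution b c A B A' B') :
    cost b c d A' + cost b c d B' ≤ cost b c d A + cost b c d B := by
  have hui := h.union_inter
  obtain ⟨m, e, he, hS, hbe, hce, hA', hB'⟩ := h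
  have hc : ∀ i, 0 ≤ c i := fun i => (hb i).trans (hbc i)
  have hM : ∀ i, c i ≤ ∑ i, c i := fun i =>
    Finset.single_le_sum (fun j _ => hc j) (Finset.mem_univ i)
  have hbd : ∀ (X : Finset (Fin n)) i, 0 ≤ (if i ∈ X then b i else c i) ∧
      (if i ∈ X then b i else c i) ≤ ∑ i, c i := by
    intro X i
    split_ifs
    · exact ⟨hb i, (hbc i).trans (hM i)⟩
    · exact ⟨hc i, hM i⟩
  obtain ⟨π', ρ', hπ⟩ := exists_perm_sum_le_of_balanced hn d _ _ _ _ (hbd A) (hbd B) (hbd A')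
    (hbd B') (fun θ i => ite_add_ite_eq_of_union_inter hui i (b i) (c i) (layer θ)) (by
      intro θ
      have h1 := sum_ite_sub_sum_ite_of_redistribution he hS
        (fun i => layer θ (b i)) (fun i => layer θ (c i))
      rw [← hA', ← hB'] at h1
      simp only [← apply_ite (layer θ)] at h1
      have h2 := alternating_sum_lowerSet_mem (fun s => ¬ θ < b (e s))
        (fun s t hst => by simpa using (hbe hst).trans)
      have h3 := alternating_sum_lowerSet_mem (fun s => ¬ θ < c (e s))
        (fun s t hst => by simpa using (hce hst).trans)
      have h4 : ∑ s : Fin m, (-1 : ℝ) ^ (s : ℕ) * (layer θ (b (e s)) - layer θ (c (e s))) =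
          ∑ s : Fin m, (if ¬ θ < c (e s) then (-1 : ℝ) ^ (s : ℕ) else 0) -
          ∑ s : Fin m, (if ¬ θ < b (e s) then (-1 : ℝ) ^ (s : ℕ) else 0) := by
        rw [← Finset.sum_sub_distrib]
        refine Finset.sum_congr rfl fun s _ => ?_
        unfold layer
        split_ifs <;> simp
      rw [h4] at h1
      rw [abs_sub_comm, h1, abs_le]
      constructor <;> linarith [h2.1, h2.2, h3.1, h3.2])
  obtain ⟨π, hπA⟩ := exists_assignCost_eq_cost b c d A
  obtain ⟨ρ, hρB⟩ := exists_assignCost_eq_cost b c d B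
  have := hπ π ρ
  rw [← hπA, ← hρB]
  exact (add_le_add (cost_le_assignCost b c d A' π') (cost_le_assignCost b c d B' ρ')).trans this

end Redistribution

/-! ### The Lagrangian relaxation -/

/-- The Lagrangian objective: the LP objective plus a penalty per unit of upgrade. -/
def lagrangian (lam : ℝ) (p : (Fin n → Fin n → ℝ) × (Fin n → Fin n → ℝ)) : ℝ :=
  ∑ i, ∑ j, ((b i * d j + lam) * p.1 i j + c i * d j * p.2 i j)

lemma lagrangian_eq (lam : ℝ) (p : (Fin n → Fin n → ℝ) × (Fin n → Fin n → ℝ)) :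
    lagrangian b c d lam p = obj b c d p + lam * ∑ i, ∑ j, p.1 i j := by
  simp only [lagrangian, obj, Finset.mul_sum, ← Finset.sum_add_distrib]
  exact Finset.sum_congr rfl fun i _ => Finset.sum_congr rfl fun j _ => by ring

lemma lagrangian_add (lam : ℝ) (p q : (Fin n → Fin n → ℝ) × (Fin n → Fin n → ℝ)) :
    lagrangian b c d lam (p + q) = lagrangian b c d lam p + lagrangian b c d lam q := by
  simp only [lagrangian, ← Finset.sum_add_distrib, Prod.fst_add, Prod.snd_add, Pi.add_apply]
  exact Finset.sum_congr rfl fun i _ => Finset.sum_congr rfl fun j _ => by ring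

lemma lagrangian_smul (lam t : ℝ) (p : (Fin n → Fin n → ℝ) × (Fin n → Fin n → ℝ)) :
    lagrangian b c d lam (t • p) = t * lagrangian b c d lam p := by
  simp only [lagrangian, Finset.mul_sum, Prod.smul_fst, Prod.smul_snd, Pi.smul_apply,
    smul_eq_mul]
  exact Finset.sum_congr rfl fun i _ => Finset.sum_congr rfl fun j _ => by ring

lemma sum_chi_fst (π : Equiv.Perm (Fin n)) (A : Finset (Fin n)) :
    ∑ i, ∑ j, (chi π A).1 i j = A.card := by
  have : ∀ i, ∑ j, (chi π A).1 i j = if i ∈ A then 1 else 0 := by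
    intro i
    rw [Finset.sum_eq_single (π.symm i)]
    · simp [chi]
    · intro j _ hj
      have : π j ≠ i := fun h => hj (by simp [← h])
      simp [chi, this]
    · simp
  simp [this]

lemma obj_chi (π : Equiv.Perm (Fin n)) (A : Finset (Fin n)) :
    obj b c d (chi π A) = assignCost b c d A π := by
  unfold obj assignCost
  rw [Finset.sum_comm]
  refine Finset.sum_congr rfl fun j _ => ?_
  rw [Finset.sum_eq_single (π j)]
  · by_cases h : π j ∈ A <;> simp [chi, h]
  · intro i _ hi
    simp [chi, hi.symm]
  · simp

lemma lagrangian_chi (lam : ℝ) (π : Equiv.Perm (Fin n)) (A : Finset (Fin n)) :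
    lagrangian b c d lam (chi π A) = assignCost b c d A π + lam * A.card := by
  rw [lagrangian_eq, obj_chi, sum_chi_fst]

/-- The points `(x, y)` with nonnegative entries for which `x + y` has all line sums `t`. -/
def BistochasticPair (t : ℝ) (p : (Fin n → Fin n → ℝ) × (Fin n → Fin n → ℝ)) : Prop :=
  (∀ i j, 0 ≤ p.1 i j) ∧ (∀ i j, 0 ≤ p.2 i j) ∧
    (∀ j, ∑ i, (p.1 i j + p.2 i j) = t) ∧ (∀ i, ∑ j, (p.1 i j + p.2 i j) = t)

variable {b c d} in
lemma BistochasticPair.add {s t : ℝ} {p q : (Fin n → Fin n → ℝ) × (Fin n → Fin n → ℝ)}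
    (hp : BistochasticPair s p) (hq : BistochasticPair t q) :
    BistochasticPair (s + t) (p + q) := by
  refine ⟨fun i j => add_nonneg (hp.1 i j) (hq.1 i j),
    fun i j => add_nonneg (hp.2.1 i j) (hq.2.1 i j), fun j => ?_, fun i => ?_⟩
  · rw [← hp.2.2.1 j, ← hq.2.2.1 j, ← Finset.sum_add_distrib]
    exact Finset.sum_congr rfl fun i _ => add_add_add_comm _ _ _ _
  · rw [← hp.2.2.2 i, ← hq.2.2.2 i, ← Finset.sum_add_distrib]
    exact Finset.sum_congr rfl fun i _ => add_add_add_comm _ _ _ _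

variable {b c d} in
lemma BistochasticPair.smul {s t : ℝ} (hs : 0 ≤ s)
    {p : (Fin n → Fin n → ℝ) × (Fin n → Fin n → ℝ)} (hp : BistochasticPair t p) :
    BistochasticPair (s * t) (s • p) := by
  refine ⟨fun i j => mul_nonneg hs (hp.1 i j),
    fun i j => mul_nonneg hs (hp.2.1 i j), fun j => ?_, fun i => ?_⟩
  · rw [← hp.2.2.1 j, Finset.mul_sum]
    exact Finset.sum_congr rfl fun i _ => (mul_add _ _ _).symm
  · rw [← hp.2.2.2 i, Finset.mul_sum]
    exact Finset.sum_congr rfl fun i _ => (mul_add _ _ _).symm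

lemma bistochasticPair_chi (π : Equiv.Perm (Fin n)) (A : Finset (Fin n)) :
    BistochasticPair 1 (chi π A) := by
  have h : ∀ i j, (chi π A).1 i j + (chi π A).2 i j = if π j = i then 1 else 0 := by
    intro i j
    by_cases hi : i ∈ A <;> simp [chi, hi]
  refine ⟨fun i j => ?_, fun i j => ?_, fun j => ?_, fun i => ?_⟩
  · simp only [chi]
    split_ifs <;> norm_num
  · simp only [chi]
    split_ifs <;> norm_num
  · simp [h]
  · simp only [h, ← Equiv.eq_symm_apply]
    simp

lemma exists_cost_add_le_sum_min (lam : ℝ) (σ : Equiv.Perm (Fin n)) :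
    ∃ X : Finset (Fin n), cost b c d X + lam * X.card ≤
      ∑ i, min (b i * d (σ i) + lam) (c i * d (σ i)) := by
  refine ⟨Finset.univ.filter fun i => b i * d (σ i) + lam < c i * d (σ i), ?_⟩
  refine (add_le_add_left (cost_le_assignCost b c d _ σ.symm) _).trans (le_of_eq ?_)
  rw [card_eq_sum_ite, Finset.mul_sum, assignCost, ← Equiv.sum_comp σ, ← Finset.sum_add_distrib]
  refine Finset.sum_congr rfl fun i _ => ?_
  simp only [Equiv.symm_apply_apply, Finset.mem_filter, Finset.mem_univ, true_and]
  split_ifs with h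
  · rw [min_eq_left h.le, mul_one]
  · rw [min_eq_right (not_lt.1 h), mul_zero, add_zero]

variable {b c d} in
lemma BistochasticPair.le_lagrangian {lam m : ℝ}
    (hm : ∀ X : Finset (Fin n), m ≤ cost b c d X + lam * X.card)
    {p : (Fin n → Fin n → ℝ) × (Fin n → Fin n → ℝ)} (hp : BistochasticPair 1 p) :
    m ≤ lagrangian b c d lam p := by
  let w : Fin n → Fin n → ℝ := fun i j => min (b i * d j + lam) (c i * d j)
  let S : Matrix (Fin n) (Fin n) ℝ := Matrix.of fun i j => p.1 i j + p.2 i j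
  have hS : S ∈ doublyStochastic ℝ (Fin n) := mem_doublyStochastic_iff_sum.2
    ⟨fun i j => add_nonneg (hp.1 i j) (hp.2.1 i j), hp.2.2.2, hp.2.2.1⟩
  obtain ⟨W, hW0, hW1, hWS⟩ := exists_eq_sum_perm_of_mem_doublyStochastic hS
  have hentry : ∀ i j, p.1 i j + p.2 i j = ∑ σ, W σ * (if σ i = j then 1 else 0) := by
    intro i j
    have := congrFun (congrFun hWS i) j
    rw [Matrix.sum_apply] at this
    rw [show p.1 i j + p.2 i j = S i j from rfl, ← this]
    refine Finset.sum_congr rfl fun σ _ => ?_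
    simp [Equiv.Perm.permMatrix, PEquiv.toMatrix_apply, eq_comm]
  calc m = ∑ σ, W σ * m := by rw [← Finset.sum_mul, hW1, one_mul]
    _ ≤ ∑ σ, W σ * ∑ i, w i (σ i) := by
        refine Finset.sum_le_sum fun σ _ => mul_le_mul_of_nonneg_left ?_ (hW0 σ)
        obtain ⟨X, hX⟩ := exists_cost_add_le_sum_min b c d lam σ
        exact (hm X).trans hX
    _ = ∑ i, ∑ j, w i j * (p.1 i j + p.2 i j) := by
        simp only [hentry, Finset.mul_sum]
        rw [Finset.sum_comm]
        refine Finset.sum_congr rfl fun i _ => ?_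
        rw [Finset.sum_comm]
        refine Finset.sum_congr rfl fun σ _ => ?_
        rw [Finset.sum_eq_single (σ i)]
        · simp [mul_comm]
        · intro j _ hj
          simp [hj.symm]
        · simp
    _ ≤ lagrangian b c d lam p := by
        refine Finset.sum_le_sum fun i _ => Finset.sum_le_sum fun j _ => ?_
        rw [mul_add]
        exact add_le_add (mul_le_mul_of_nonneg_right (min_le_left _ _) (hp.1 i j))
          (mul_le_mul_of_nonneg_right (min_le_right _ _) (hp.2.1 i j))

variable {b c d} in
lemma BistochasticPair.two_mul_le_lagrangian {lam m : ℝ}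
    (hm : ∀ X : Finset (Fin n), m ≤ cost b c d X + lam * X.card)
    {p : (Fin n → Fin n → ℝ) × (Fin n → Fin n → ℝ)} (hp : BistochasticPair 2 p) :
    2 * m ≤ lagrangian b c d lam p := by
  have h : BistochasticPair 1 ((1 / 2 : ℝ) • p) := by
    have := hp.smul (s := 1 / 2) (by norm_num)
    norm_num at this ⊢
    exact this
  have := h.le_lagrangian hm
  rw [lagrangian_smul] at this
  linarith

/-- The matrix with a single nonzero entry, equal to `1`, at `(i, j)`. -/
def unitMatrix (i j : Fin n) (i' j' : Fin n) : ℝ := if i' = i then if j' = j then 1 else 0 else 0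

lemma unitMatrix_nonneg (i j i' j' : Fin n) : 0 ≤ unitMatrix i j i' j' := by
  unfold unitMatrix
  split_ifs <;> norm_num

lemma sum_unitMatrix_row (i j i' : Fin n) :
    ∑ j', unitMatrix i j i' j' = if i' = i then 1 else 0 := by
  unfold unitMatrix
  split_ifs <;> simp

lemma sum_unitMatrix_col (i j j' : Fin n) :
    ∑ i', unitMatrix i j i' j' = if j' = j then 1 else 0 := by
  simp [unitMatrix]

lemma sum_sum_mul_unitMatrix (w : Fin n → Fin n → ℝ) (i j : Fin n) :
    ∑ i', ∑ j', w i' j' * unitMatrix i j i' j' = w i j := by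
  rw [Finset.sum_eq_single i]
  · simp [unitMatrix]
  · intro i' _ hi'
    simp [unitMatrix, hi']
  · simp

lemma lagrangian_unitMatrix (lam : ℝ) (x y : Fin n → Fin n → ℝ) (i j i' j' k l k' l' : Fin n) :
    lagrangian b c d lam
      (x + (unitMatrix i j - unitMatrix i' j'), y + (unitMatrix k l - unitMatrix k' l')) =
      lagrangian b c d lam (x, y) + ((b i * d j + lam) - (b i' * d j' + lam)) +
        (c k * d l - c k' * d l') := by
  rw [← sum_sum_mul_unitMatrix (fun i j => b i * d j + lam) i j,
    ← sum_sum_mul_unitMatrix (fun i j => b i * d j + lam) i' j',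
    ← sum_sum_mul_unitMatrix (fun i j => c i * d j) k l,
    ← sum_sum_mul_unitMatrix (fun i j => c i * d j) k' l']
  simp only [lagrangian, ← Finset.sum_add_distrib, ← Finset.sum_sub_distrib, Pi.add_apply,
    Pi.sub_apply]
  exact Finset.sum_congr rfl fun i _ => Finset.sum_congr rfl fun j _ => by ring

lemma unitMatrix_le {x : Fin n → Fin n → ℝ} (hx : ∀ i j, 0 ≤ x i j) {i j : Fin n}
    (h : 1 ≤ x i j) (i' j' : Fin n) : unitMatrix i j i' j' ≤ x i' j' := by
  unfold unitMatrix
  split_ifs with h1 h2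
  · subst h1 h2
    exact h
  · exact hx _ _
  · exact hx _ _

variable {b c d} in
/-- Two suppliers swap a unit of upgraded and a unit of non-upgraded service. -/
lemma BistochasticPair.swap {t : ℝ} {x y : Fin n → Fin n → ℝ} (h : BistochasticPair t (x, y))
    {i s j l : Fin n} (hx : 1 ≤ x s j) (hy : 1 ≤ y i l) :
    BistochasticPair t
      (x + (unitMatrix i j - unitMatrix s j), y + (unitMatrix s l - unitMatrix i l)) := by
  have hsum : ∀ i' j', (x + (unitMatrix i j - unitMatrix s j)) i' j' +
      (y + (unitMatrix s l - unitMatrix i l)) i' j' = (x i' j' + y i' j') +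
        (unitMatrix i j i' j' - unitMatrix s j i' j' +
          (unitMatrix s l i' j' - unitMatrix i l i' j')) := by
    intro i' j'
    simp only [Pi.add_apply, Pi.sub_apply]
    ring
  refine ⟨fun i' j' => ?_, fun i' j' => ?_, fun j' => ?_, fun i' => ?_⟩
  · have := unitMatrix_le h.1 hx i' j'
    have := unitMatrix_nonneg i j i' j'
    simp only [Pi.add_apply, Pi.sub_apply] at *
    linarith
  · have := unitMatrix_le h.2.1 hy i' j'
    have := unitMatrix_nonneg s l i' j'
    simp only [Pi.add_apply, Pi.sub_apply] at *
    linarith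
  · simp only [hsum]
    rw [Finset.sum_add_distrib, h.2.2.1 j', Finset.sum_add_distrib, Finset.sum_sub_distrib,
      Finset.sum_sub_distrib]
    simp only [sum_unitMatrix_col]
    ring
  · simp only [hsum]
    rw [Finset.sum_add_distrib, h.2.2.2 i', Finset.sum_add_distrib, Finset.sum_sub_distrib,
      Finset.sum_sub_distrib]
    simp only [sum_unitMatrix_row]
    ring

variable {b c d} in
lemma BistochasticPair.downgrade {t : ℝ} {x y : Fin n → Fin n → ℝ}
    (h : BistochasticPair t (x, y)) {s j : Fin n} (hx : 1 ≤ x s j) :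
    BistochasticPair t (x - unitMatrix s j, y + unitMatrix s j) := by
  have hsum : ∀ i' j', (x - unitMatrix s j) i' j' + (y + unitMatrix s j) i' j' =
      x i' j' + y i' j' := by
    intro i' j'
    simp only [Pi.add_apply, Pi.sub_apply]
    ring
  refine ⟨fun i' j' => sub_nonneg.2 (unitMatrix_le h.1 hx i' j'),
    fun i' j' => add_nonneg (h.2.1 i' j') (unitMatrix_nonneg s j i' j'), fun j' => ?_, fun i' => ?_⟩
  · simp only [hsum]
    exact h.2.2.1 j'
  · simp only [hsum]
    exact h.2.2.2 i'

lemma lagrangian_downgrade (lam : ℝ) (x y : Fin n → Fin n → ℝ) (s j : Fin n) :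
    lagrangian b c d lam (x - unitMatrix s j, y + unitMatrix s j) =
      lagrangian b c d lam (x, y) + c s * d j - (b s * d j + lam) := by
  rw [← sum_sum_mul_unitMatrix (fun i j => c i * d j) s j,
    ← sum_sum_mul_unitMatrix (fun i j => b i * d j + lam) s j]
  simp only [lagrangian, ← Finset.sum_add_distrib, ← Finset.sum_sub_distrib, Pi.add_apply,
    Pi.sub_apply]
  exact Finset.sum_congr rfl fun i _ => Finset.sum_congr rfl fun j _ => by ring

lemma exists_one_le_chi_add_chi {A B : Finset (Fin n)} (π ρ : Equiv.Perm (Fin n)) {i : Fin n}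
    (hi : i ∈ symmDiff A B) :
    (∃ j, 1 ≤ (chi π A + chi ρ B).1 i j) ∧ ∃ j, 1 ≤ (chi π A + chi ρ B).2 i j := by
  have hA := bistochasticPair_chi π A
  have hB := bistochasticPair_chi ρ B
  rcases Finset.mem_symmDiff.1 hi with ⟨h1, h2⟩ | ⟨h1, h2⟩
  · refine ⟨⟨π.symm i, le_add_of_le_of_nonneg ?_ (hB.1 _ _)⟩,
      ⟨ρ.symm i, le_add_of_nonneg_of_le (hA.2.1 _ _) ?_⟩⟩
    · simp [chi, h1]
    · simp [chi, h2]
  · refine ⟨⟨ρ.symm i, le_add_of_nonneg_of_le (hA.1 _ _) ?_⟩,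
      ⟨π.symm i, le_add_of_le_of_nonneg ?_ (hB.2.1 _ _)⟩⟩
    · simp [chi, h1]
    · simp [chi, h2]

/-- `A` minimizes the cost plus a penalty of `lam` per upgrade. -/
def LagrangianMin (lam : ℝ) (A : Finset (Fin n)) : Prop :=
  ∀ X : Finset (Fin n), cost b c d A + lam * A.card ≤ cost b c d X + lam * X.card

variable {b c d} in
/-- For a positive penalty, the symmetric difference of two minimizers contains no two strictly
nested suppliers. -/
lemma LagrangianMin.clean {lam : ℝ} (hlam : 0 < lam) (hd : ∀ j, 0 ≤ d j) {A B : Finset (Fin n)}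
    (hA : LagrangianMin b c d lam A) (hB : LagrangianMin b c d lam B) : Clean b c A B := by
  rintro i hi s hs ⟨hbis, hcsi⟩
  obtain ⟨π, hπ⟩ := exists_assignCost_eq_cost b c d A
  obtain ⟨ρ, hρ⟩ := exists_assignCost_eq_cost b c d B
  have hAB := le_antisymm (hA B) (hB A)
  obtain ⟨j, hj⟩ := (exists_one_le_chi_add_chi π ρ hs).1
  obtain ⟨l, hl⟩ := (exists_one_le_chi_add_chi π ρ hi).2
  have hP : BistochasticPair 2 (chi π A + chi ρ B) := by
    have := (bistochasticPair_chi π A).add (bistochasticPair_chi ρ B)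
    norm_num at this
    exact this
  have hvalue : lagrangian b c d lam (chi π A + chi ρ B) =
      2 * (cost b c d A + lam * A.card) := by
    rw [lagrangian_add, lagrangian_chi, lagrangian_chi, hπ, hρ, ← hAB]
    ring
  have h1 := (hP.swap hj hl).two_mul_le_lagrangian hA
  rw [lagrangian_unitMatrix] at h1
  change _ ≤ lagrangian b c d lam (chi π A + chi ρ B) + _ + _ at h1
  rw [hvalue] at h1
  have hj0 : d j = 0 := by
    have h2 : (c s - c i) * d l ≤ 0 := mul_nonpos_of_nonpos_of_nonneg (by linarith) (hd l)
    by_contra hne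
    have h3 : (b i - b s) * d j < 0 :=
      mul_neg_of_neg_of_pos (by linarith) (lt_of_le_of_ne (hd j) (Ne.symm hne))
    linarith
  have h4 := (hP.downgrade hj).two_mul_le_lagrangian hA
  rw [lagrangian_downgrade] at h4
  change _ ≤ lagrangian b c d lam (chi π A + chi ρ B) + _ - _ at h4
  rw [hvalue, hj0] at h4
  linarith

variable {b c d} in
lemma LagrangianMin.exists_card_eq_of_pos (hn : 1 ≤ n) (hb : ∀ i, 0 ≤ b i)
    (hbc : ∀ i, b i ≤ c i) (hd : ∀ j, 0 ≤ d j) {lam : ℝ} (hlam : 0 < lam) {k : ℕ}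
    (g : ℕ) : ∀ {A B : Finset (Fin n)}, B.card - A.card ≤ g →
      LagrangianMin b c d lam A → LagrangianMin b c d lam B → A.card ≤ k → k ≤ B.card →
      ∃ X, X.card = k ∧ LagrangianMin b c d lam X := by
  induction g with
  | zero =>
    intro A B hg hA hB hAk hkB
    exact ⟨A, by omega, hA⟩
  | succ g ih =>
    intro A B hg hA hB hAk hkB
    by_cases hAk' : A.card = k
    · exact ⟨A, hAk', hA⟩
    by_cases hkB' : B.card = k
    · exact ⟨B, hkB', hB⟩
    obtain ⟨A', B', hred⟩ := (hA.clean hlam hd hB).exists_redistribution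
    have hcost := hred.cost_add_cost_le d hn hb hbc
    obtain ⟨hcard, h1, h2⟩ := hred.card
    have hcard' : (A'.card : ℝ) + B'.card = A.card + B.card := by exact_mod_cast hcard
    have hB' : LagrangianMin b c d lam B' := by
      intro X
      have := hA X
      have := hB A'
      have := hA B
      have : lam * A'.card + lam * B'.card = lam * A.card + lam * B.card := by
        rw [← mul_add, ← mul_add, hcard']
      linarith
    rcases le_total k B'.card with hk | hk
    · exact ih (by omega) hA hB' hAk hk
    · exact ih (by omega) hB' hB hk hkB

variable {b c d} in
lemma LagrangianMin.exists_card_eq (hn : 1 ≤ n) (hb : ∀ i, 0 ≤ b i)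
    (hbc : ∀ i, b i ≤ c i) (hd : ∀ j, 0 ≤ d j) {lam : ℝ} (hlam : 0 ≤ lam) {k : ℕ}
    {A B : Finset (Fin n)} (hA : LagrangianMin b c d lam A) (hB : LagrangianMin b c d lam B)
    (hAk : A.card ≤ k) (hkB : k ≤ B.card) :
    ∃ X, X.card = k ∧ LagrangianMin b c d lam X := by
  rcases hlam.eq_or_lt with rfl | hpos
  · obtain ⟨X, hAX, -, hX⟩ := Finset.exists_subsuperset_card_eq (Finset.subset_univ A) hAk
      (hkB.trans (Finset.card_le_univ B))
    refine ⟨X, hX, fun Y => ?_⟩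
    have := hA Y
    have := cost_antitone b c d hbc hd hAX
    linarith
  · exact LagrangianMin.exists_card_eq_of_pos hn hb hbc hd hpos _ le_rfl hA hB hAk hkB

lemma exists_lagrangianMin_pair (hbc : ∀ i, b i ≤ c i) (hd : ∀ j, 0 ≤ d j) {k : ℕ} (hk : k ≤ n) :
    ∃ lam : ℝ, 0 ≤ lam ∧ ∃ A B : Finset (Fin n), A.card ≤ k ∧ k ≤ B.card ∧
      LagrangianMin b c d lam A ∧ LagrangianMin b c d lam B := by
  let G : Finset (Fin n) → ℝ → ℝ := fun X lam => cost b c d X + lam * X.card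
  let S : Finset (Finset (Fin n)) := Finset.univ.filter fun X => X.card ≤ k
  let T : Finset (Finset (Fin n)) := Finset.univ.filter fun X => k ≤ X.card
  have hS : S.Nonempty := ⟨∅, by simp [S]⟩
  have hT : T.Nonempty := ⟨Finset.univ, by simpa [T] using hk⟩
  have hcont : ∀ (R : Finset (Finset (Fin n))) (hR : R.Nonempty),
      Continuous fun lam => R.inf' hR fun X => G X lam := by
    intro R hR
    exact Continuous.finset_inf'_apply hR fun X _ => by fun_prop
  set Λ : ℝ := cost b c d ∅ - cost b c d Finset.univ
  have hΛ : 0 ≤ Λ := sub_nonneg.2 (cost_antitone b c d hbc hd (Finset.empty_subset _))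
  have h0 : T.inf' hT (fun X => G X 0) ≤ S.inf' hS (fun X => G X 0) := by
    refine Finset.le_inf' _ _ fun X _ => ?_
    refine (Finset.inf'_le _ (b := Finset.univ) (by simpa [T] using hk)).trans ?_
    simpa [G] using cost_antitone b c d hbc hd (Finset.subset_univ X)
  have h1 : S.inf' hS (fun X => G X Λ) ≤ T.inf' hT (fun X => G X Λ) := by
    refine Finset.le_inf' _ _ fun X _ => ?_
    refine (Finset.inf'_le _ (b := ∅) (by simp [S])).trans ?_
    rcases X.eq_empty_or_nonempty with rfl | hX
    · exact le_rfl
    · have h2 : (1 : ℝ) ≤ X.card := by exact_mod_cast hX.card_pos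
      have h3 := cost_antitone b c d hbc hd (Finset.subset_univ X)
      have h4 : Λ ≤ Λ * X.card := le_mul_of_one_le_right hΛ h2
      simp only [G, Finset.card_empty, Nat.cast_zero, mul_zero, add_zero]
      linarith
  obtain ⟨lam, hlam, heq⟩ : ∃ lam ∈ Set.Icc 0 Λ,
      S.inf' hS (fun X => G X lam) = T.inf' hT (fun X => G X lam) :=
    isPreconnected_Icc.intermediate_value₂ (Set.right_mem_Icc.2 hΛ) (Set.left_mem_Icc.2 hΛ)
      (hcont S hS).continuousOn (hcont T hT).continuousOn h1 h0
  obtain ⟨A, hA, hAS⟩ := Finset.exists_mem_eq_inf' hS fun X => G X lam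
  obtain ⟨B, hB, hBT⟩ := Finset.exists_mem_eq_inf' hT fun X => G X lam
  have hmin : ∀ X, S.inf' hS (fun X => G X lam) ≤ G X lam := by
    intro X
    rcases le_total X.card k with hX | hX
    · exact Finset.inf'_le _ (by simpa [S] using hX)
    · rw [heq]
      exact Finset.inf'_le _ (by simpa [T] using hX)
  exact ⟨lam, hlam.1, A, B, by simpa [S] using hA, by simpa [T] using hB,
    fun X => hAS.symm.trans_le (hmin X),
    fun X => (hBT.symm.trans heq.symm).trans_le (hmin X)⟩

variable {b c d} in
/-- A set of minimum cost among those of its size minimizes some Lagrangian; equivalently, the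
minimum cost is a convex function of the number of upgrades. -/
lemma exists_lagrangianMin_of_cost_eq_hval (hn : 1 ≤ n) (hb : ∀ i, 0 ≤ b i)
    (hbc : ∀ i, b i ≤ c i) (hd : ∀ j, 0 ≤ d j) {A : Finset (Fin n)}
    (hA : cost b c d A = hval b c d A.card) : ∃ lam, LagrangianMin b c d lam A := by
  obtain ⟨lam, hlam, X, Y, hX, hY, hminX, hminY⟩ := exists_lagrangianMin_pair b c d hbc hd
    (k := A.card) ((Finset.card_le_univ A).trans (by simp))
  obtain ⟨Z, hZ, hminZ⟩ := hminX.exists_card_eq hn hb hbc hd hlam hminY hX hY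
  refine ⟨lam, fun W => ?_⟩
  have h1 := hminZ W
  have h2 := hval_le_cost b c d Z
  rw [hZ] at h1 h2
  linarith

end Cost

/-- if no "extreme set" exists for the Lagrangian penalty `λ`,
then the weakly optimal pair `(A, B)` is an optimal pair. -/
theorem stmt14 (n : ℕ) (hn : 1 ≤ n) (b c d : Fin n → ℝ)
    (hb : ∀ i, 0 ≤ b i) (hbc : ∀ i, b i ≤ c i) (hd : ∀ j, 0 ≤ d j) (k : ℕ)
    (A B : Finset (Fin n)) (hA : A.card < k) (hB : k < B.card)
    (hcA : cost b c d A = hval b c d A.card)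
    (hcB : cost b c d B = hval b c d B.card)
    (lam : ℝ)
    (hlam : lam = (cost b c d A - cost b c d B) / ((B.card : ℝ) - A.card))
    (hnoextreme : ∀ X : Finset (Fin n), A.card < X.card → X.card < B.card →
      cost b c d X = hval b c d X.card →
      cost b c d A + lam * A.card ≤ cost b c d X + lam * X.card) :
    OptimalPair b c d k A B := by
  have hab : (A.card : ℝ) < B.card := by exact_mod_cast hA.trans hB
  have hAk : (A.card : ℝ) < k := by exact_mod_cast hA
  have hkB : (k : ℝ) < B.card := by exact_mod_cast hB
  have hgap : (0 : ℝ) < (B.card : ℝ) - A.card := sub_pos.2 hab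
  have hlam' : lam * ((B.card : ℝ) - A.card) = cost b c d A - cost b c d B := by
    rw [hlam, div_mul_cancel₀ _ hgap.ne']
  have hlam0 : 0 ≤ lam := by
    obtain ⟨X, hAX, -, hX⟩ := Finset.exists_subsuperset_card_eq (Finset.subset_univ A)
      (hA.trans hB).le (Finset.card_le_univ B)
    have h1 := cost_antitone b c d hbc hd hAX
    have h2 := hval_le_cost b c d X
    rw [hX, ← hcB] at h2
    rw [hlam]
    exact div_nonneg (by linarith) hgap.le
  have hmin : LagrangianMin b c d lam A := by
    obtain ⟨μ, hμ⟩ := exists_lagrangianMin_of_cost_eq_hval hn hb hbc hd hcA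
    obtain ⟨ν, hν⟩ := exists_lagrangianMin_of_cost_eq_hval hn hb hbc hd hcB
    have hμlam : lam ≤ μ := by
      refine le_of_mul_le_mul_right ?_ hgap
      linarith [hμ B]
    have hνlam : ν ≤ lam := by
      refine le_of_mul_le_mul_right ?_ hgap
      linarith [hν A]
    intro X
    rcases le_or_gt X.card A.card with hXA | hXA
    · have hXA' : (X.card : ℝ) ≤ A.card := by exact_mod_cast hXA
      nlinarith [hμ X, mul_nonneg (sub_nonneg.2 hμlam) (sub_nonneg.2 hXA')]
    rcases le_or_gt B.card X.card with hXB | hXB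
    · have hXB' : (B.card : ℝ) ≤ X.card := by exact_mod_cast hXB
      nlinarith [hν X, mul_nonneg (sub_nonneg.2 hνlam) (sub_nonneg.2 hXB')]
    obtain ⟨Y, hYX, hY⟩ := exists_cost_eq_hval b c d (m := X.card)
      ((Finset.card_le_univ X).trans (by simp))
    have h1 := hnoextreme Y (by omega) (by omega) (by rw [hY, hYX])
    have h2 := hval_le_cost b c d X
    rw [hY, hYX] at h1
    linarith
  have hf : fpair b c d k A B = cost b c d A + lam * A.card - lam * k := by
    rw [fpair, div_eq_iff hgap.ne']
    linear_combination ((k : ℝ) - A.card) * hlam'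
  refine ⟨hA, hB, ?_, ?_⟩
  · obtain ⟨π, hπ⟩ := exists_assignCost_eq_cost b c d A
    obtain ⟨ρ, hρ⟩ := exists_assignCost_eq_cost b c d B
    set α : ℝ := ((B.card : ℝ) - k) / ((B.card : ℝ) - A.card) with hα
    set β : ℝ := ((k : ℝ) - A.card) / ((B.card : ℝ) - A.card) with hβ
    have hα0 : 0 ≤ α := div_nonneg (by linarith) hgap.le
    have hβ0 : 0 ≤ β := div_nonneg (by linarith) hgap.le
    have hsum : α + β = 1 := by
      rw [hα, hβ]
      field_simp
      ring
    have hcard : α * A.card + β * B.card = k := by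
      rw [hα, hβ]
      field_simp
      ring
    have hpair := ((bistochasticPair_chi π A).smul hα0).add ((bistochasticPair_chi ρ B).smul hβ0)
    rw [mul_one, mul_one, hsum] at hpair
    have hx : ∑ i, ∑ j, (α • chi π A + β • chi ρ B).1 i j = k := by
      rw [← hcard, ← sum_chi_fst π A, ← sum_chi_fst ρ B]
      simp only [Finset.mul_sum, ← Finset.sum_add_distrib]
      rfl
    refine ⟨α • chi π A + β • chi ρ B,
      ⟨hpair.1, hpair.2.1, hpair.2.2.1, hpair.2.2.2, hx.le⟩, ?_⟩
    have h := lagrangian_eq b c d lam (α • chi π A + β • chi ρ B)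
    rw [hx, lagrangian_add, lagrangian_smul, lagrangian_smul, lagrangian_chi, lagrangian_chi,
      hπ, hρ] at h
    rw [hf]
    linear_combination -h + (cost b c d A + lam * A.card) * hsum + β * hlam'
  · rintro _ ⟨p, ⟨hx, hy, hcol, hrow, hle⟩, rfl⟩
    have h := BistochasticPair.le_lagrangian hmin (p := p) ⟨hx, hy, hcol, hrow⟩
    rw [lagrangian_eq] at h
    have := mul_le_mul_of_nonneg_left hle hlam0
    rw [hf]
    linarith
end

section
/- The polytope P(k) can have a non-integral optimal point: for the instance with n = 2, b = (0, 2), c = (1, 3), d = (1, 1) and k = 1 (indexing suppliers and customers by 1, 2), every (x, y) ∈ P(1) satisfies obj(x, y) ≥ 3; the point (x*, y*) with x*_{1,2} = x*_{2,1} = y*_{1,1} = y*_{2,2} = 1/2 and all other entries 0 lies in P(1), is not integral, satisfies obj(x*, y*) = 3, and is an extreme point of P(1); and the integral point with x_{1,1} = 1, y_{2,2} = 1 and all other entries 0 also lies in P(1) with objective 3. -/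
open Finset

theorem mem_Pk_two_one {p : (Fin 2 → Fin 2 → ℝ) × (Fin 2 → Fin 2 → ℝ)} :
    p ∈ Pk 2 1 ↔
      ((0 ≤ p.1 0 0 ∧ 0 ≤ p.1 0 1) ∧ 0 ≤ p.1 1 0 ∧ 0 ≤ p.1 1 1) ∧
      ((0 ≤ p.2 0 0 ∧ 0 ≤ p.2 0 1) ∧ 0 ≤ p.2 1 0 ∧ 0 ≤ p.2 1 1) ∧
      (p.1 0 0 + p.2 0 0 + (p.1 1 0 + p.2 1 0) = 1 ∧
        p.1 0 1 + p.2 0 1 + (p.1 1 1 + p.2 1 1) = 1) ∧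
      (p.1 0 0 + p.2 0 0 + (p.1 0 1 + p.2 0 1) = 1 ∧
        p.1 1 0 + p.2 1 0 + (p.1 1 1 + p.2 1 1) = 1) ∧
      p.1 0 0 + p.1 0 1 + (p.1 1 0 + p.1 1 1) ≤ 1 := by
  simp [Pk, Fin.forall_fin_two, Fin.sum_univ_two]

theorem eq_zero_of_pos_combination_eq_zero {s t u v : ℝ} (hs : 0 < s) (ht : 0 < t)
    (hu : 0 ≤ u) (hv : 0 ≤ v) (h : s * u + t * v = 0) : u = 0 ∧ v = 0 := by
  have hsu := mul_nonneg hs.le hu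
  have htv := mul_nonneg ht.le hv
  refine ⟨(mul_eq_zero.mp (by linarith : s * u = 0)).resolve_left hs.ne', ?_⟩
  exact (mul_eq_zero.mp (by linarith : t * v = 0)).resolve_left ht.ne'

/-- an explicit instance where `P(1)` has both a fractional
optimal extreme point and an integral optimal point. -/
theorem stmt17 (b c d : Fin 2 → ℝ)
    (hbdef : b = ![0, 2]) (hcdef : c = ![1, 3]) (hddef : d = ![1, 1])
    (pstar q : (Fin 2 → Fin 2 → ℝ) × (Fin 2 → Fin 2 → ℝ))
    (hp1 : pstar.1 = fun i j => if (i = 0 ∧ j = 1) ∨ (i = 1 ∧ j = 0) then (1 : ℝ) / 2 else 0)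
    (hp2 : pstar.2 = fun i j => if i = j then (1 : ℝ) / 2 else 0)
    (hq1 : q.1 = fun i j => if i = 0 ∧ j = 0 then (1 : ℝ) else 0)
    (hq2 : q.2 = fun i j => if i = 1 ∧ j = 1 then (1 : ℝ) else 0) :
    (∀ p ∈ Pk 2 1, 3 ≤ obj b c d p) ∧
    pstar ∈ Pk 2 1 ∧ ¬ Integral pstar ∧ obj b c d pstar = 3 ∧
    pstar ∈ Set.extremePoints ℝ (Pk 2 1) ∧
    q ∈ Pk 2 1 ∧ Integral q ∧ obj b c d q = 3 := by
  obtain ⟨x, y⟩ := pstar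
  obtain ⟨x', y'⟩ := q
  dsimp only at hp1 hp2 hq1 hq2
  subst hbdef hcdef hddef hp1 hp2 hq1 hq2
  have hmem : ((fun i j => if (i = 0 ∧ j = 1) ∨ (i = 1 ∧ j = 0) then (1 : ℝ) / 2 else 0,
      fun i j => if i = j then (1 : ℝ) / 2 else 0) :
      (Fin 2 → Fin 2 → ℝ) × (Fin 2 → Fin 2 → ℝ)) ∈ Pk 2 1 := by
    rw [mem_Pk_two_one]
    norm_num
  refine ⟨?_, hmem, ?_, ?_, ⟨hmem, ?_⟩, ?_, ?_, ?_⟩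
  · intro p hp
    obtain ⟨⟨⟨_, _⟩, _, _⟩, ⟨⟨_, _⟩, _, _⟩, ⟨_, _⟩, ⟨_, _⟩, _⟩ := mem_Pk_two_one.mp hp
    simp [obj, Fin.sum_univ_two]
    linarith
  · intro h
    have := h.1 0 1
    norm_num at this
  · norm_num [obj, Fin.sum_univ_two]
  · rintro u hu v hv ⟨s, t, hs, ht, hst, h⟩
    obtain ⟨⟨⟨hu1, hu2⟩, hu3, hu4⟩, ⟨⟨hu5, hu6⟩, hu7, hu8⟩, ⟨_, _⟩, ⟨_, _⟩, hu9⟩ :=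
      mem_Pk_two_one.mp hu
    obtain ⟨⟨⟨hv1, hv2⟩, hv3, hv4⟩, ⟨⟨hv5, hv6⟩, hv7, hv8⟩, ⟨_, _⟩, ⟨_, _⟩, hv9⟩ :=
      mem_Pk_two_one.mp hv
    have hx (i j : Fin 2) := congrFun (congrFun (congrArg Prod.fst h) i) j
    have hy (i j : Fin 2) := congrFun (congrFun (congrArg Prod.snd h) i) j
    simp only [Prod.fst_add, Prod.snd_add, Prod.smul_fst, Prod.smul_snd, Pi.add_apply,
      Pi.smul_apply, smul_eq_mul] at hx hy
    obtain ⟨a1, b1⟩ := eq_zero_of_pos_combination_eq_zero hs ht hu1 hv1 (by simpa using hx 0 0)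
    obtain ⟨a2, b2⟩ := eq_zero_of_pos_combination_eq_zero hs ht hu4 hv4 (by simpa using hx 1 1)
    obtain ⟨a3, b3⟩ := eq_zero_of_pos_combination_eq_zero hs ht hu6 hv6 (by simpa using hy 0 1)
    obtain ⟨a4, b4⟩ := eq_zero_of_pos_combination_eq_zero hs ht hu7 hv7 (by simpa using hy 1 0)
    have hhalf : s * u.1 0 1 + t * v.1 0 1 = 1 / 2 := by simpa using hx 0 1
    have hsv : s * (1 / 2 - u.1 0 1) + t * (1 / 2 - v.1 0 1) = 0 := by linarith
    obtain ⟨hux, -⟩ := eq_zero_of_pos_combination_eq_zero hs ht (by linarith) (by linarith) hsv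
    have e1 : u.1 0 1 = 1 / 2 := by linarith
    have e2 : u.1 1 0 = 1 / 2 := by linarith
    have e3 : u.2 0 0 = 1 / 2 := by linarith
    have e4 : u.2 1 1 = 1 / 2 := by linarith
    ext i j <;> fin_cases i <;> fin_cases j <;> simp [a1, a2, a3, a4, e1, e2, e3, e4]
  · rw [mem_Pk_two_one]
    norm_num
  · simp [Integral, Fin.forall_fin_two]
  · norm_num [obj, Fin.sum_univ_two]
end

section
/- Assume the 2n real numbers b i and c i (i ∈ Fin n) are pairwise distinct and the demands d j (j ∈ Fin n) are pairwise distinct. Let λ ∈ (0, 1), let A, B ⊆ Fin n with |A| < k < |B|, and let π_A, π_B be permutations of Fin n attaining cost(A) and cost(B) respectively, such that the point λ · χ(π_A, A) + (1 − λ) · χ(π_B, B) lies in P(k) and its objective obj equals the minimum of obj over P(k). Then for every orbit O of the permutation i ↦ π_A(π_B⁻¹ i) of Fin n, the cardinalities |A ∩ O| and |B ∩ O| differ by at most 1. -/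
open Finset

/-- `q` does not lie strictly between `x` and `y`. -/
def NotBetween (q x y : ℝ) : Prop := (q ≤ x ∧ q ≤ y) ∨ (x ≤ q ∧ y ≤ q)

theorem NotBetween.swap {q x y : ℝ} (h : NotBetween q x y) : NotBetween q y x :=
  h.imp And.symm And.symm

theorem notBetween_left (x y : ℝ) : NotBetween x x y :=
  (le_total x y).imp (fun h => ⟨le_rfl, h⟩) (fun h => ⟨le_rfl, h⟩)

theorem notBetween_of_adjacent {p r x y : ℝ} (hrx : r ≠ x) (hry : r ≠ y)
    (hr : NotBetween r x y) (hx : NotBetween x p r) (hy : NotBetween y p r) :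
    NotBetween p x y := by
  grind [NotBetween]

theorem NotBetween.trans {q x y z w : ℝ} (hy : q ≠ y) (hz : q ≠ z) (hxy : NotBetween q x y)
    (hyz : NotBetween q y z) (hzw : NotBetween q z w) : NotBetween q x w := by
  grind [NotBetween]

/-- `f` permutes `S` in a single cycle: it is injective on `S`, preserves `S`, and the only
nonempty subset of `S` closed under `f` is `S`. -/
structure CyclesOn {α : Type*} (f : α → α) (S : Finset α) : Prop where
  mapsTo : ∀ v ∈ S, f v ∈ S
  injOn : ∀ v ∈ S, ∀ w ∈ S, f v = f w → v = w
  minimal : ∀ T ⊆ S, T.Nonempty → (∀ t ∈ T, f t ∈ T) → T = S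

/-- The map obtained from `f` by bypassing `v`. -/
def bypass {α : Type*} [DecidableEq α] (f : α → α) (v z : α) : α :=
  if f z = v then f v else f z

namespace CyclesOn

variable {α : Type*} {f : α → α} {S : Finset α}

theorem exists_pred [DecidableEq α] (h : CyclesOn f S) {v : α} (hv : v ∈ S) : ∃ z ∈ S, f z = v := by
  have himg : S.image f = S :=
    Finset.eq_of_subset_of_card_le (by
      intro x hx
      obtain ⟨z, hz, rfl⟩ := Finset.mem_image.1 hx
      exact h.mapsTo z hz)
      (Finset.card_image_of_injOn (fun x hx y hy hxy => h.injOn x hx y hy hxy)).ge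
  rw [← himg] at hv
  exact Finset.mem_image.1 hv

theorem apply_ne_self (h : CyclesOn f S) (hS : 1 < S.card) {v : α} (hv : v ∈ S) : f v ≠ v := by
  intro hfv
  have := h.minimal {v} (by simpa using hv) ⟨v, by simp⟩ (by simp [hfv])
  rw [← this] at hS
  simp at hS

theorem bypass_erase [DecidableEq α] (h : CyclesOn f S) (hS : 1 < S.card) {v : α} (hv : v ∈ S) :
    CyclesOn (bypass f v) (S.erase v) := by
  have hne := h.apply_ne_self hS hv
  refine ⟨?_, ?_, ?_⟩
  · intro z hz
    have hz' := Finset.mem_of_mem_erase hz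
    unfold bypass
    split_ifs with hzv
    · exact Finset.mem_erase.2 ⟨hne, h.mapsTo v hv⟩
    · exact Finset.mem_erase.2 ⟨hzv, h.mapsTo z hz'⟩
  · intro z hz w hw hzw
    obtain ⟨hz1, hz2⟩ := Finset.mem_erase.1 hz
    obtain ⟨hw1, hw2⟩ := Finset.mem_erase.1 hw
    unfold bypass at hzw
    split_ifs at hzw with h1 h2 h2
    · exact h.injOn z hz2 w hw2 (h1.trans h2.symm)
    · exact absurd (h.injOn v hv w hw2 hzw).symm hw1
    · exact absurd (h.injOn z hz2 v hv hzw) hz1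
    · exact h.injOn z hz2 w hw2 hzw
  · intro T hT hTne hTf
    have hvT : v ∉ T := fun hvT => by simpa using hT hvT
    have hTS : T ⊆ S := hT.trans (Finset.erase_subset _ _)
    by_cases hz : ∃ z ∈ T, f z = v
    · obtain ⟨z, hzT, hzv⟩ := hz
      have hfv : f v ∈ T := by
        have := hTf z hzT
        simpa [bypass, hzv] using this
      have := h.minimal (insert v T) (Finset.insert_subset hv hTS) ⟨v, by simp⟩ (by
        intro t ht
        rcases Finset.mem_insert.1 ht with rfl | ht
        · exact Finset.mem_insert_of_mem hfv
        · by_cases htv : f t = v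
          · simp [htv]
          · have := hTf t ht
            rw [bypass, if_neg htv] at this
            exact Finset.mem_insert_of_mem this)
      rw [← this, Finset.erase_insert hvT]
    · push Not at hz
      have := h.minimal T hTS hTne (by
        intro t ht
        have h2 := hTf t ht
        rwa [bypass, if_neg (hz t ht)] at h2)
      exact absurd (this ▸ hv) hvT

end CyclesOn

/-- A single cycle of suppliers, each carrying two labels `a v` and `e v`, such that labels of
distinct suppliers differ, the label intervals are pairwise not nested, and no label separates
`e v` from `a (f v)`. Then the numbers of ascending and descending suppliers differ by at
most one: the cycle is a simple closed curve, so its winding number is `-1`, `0` or `1`. -/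
theorem abs_sum_sign_le_one {α : Type*} [DecidableEq α] (a e : α → ℝ) (m : ℕ) :
    ∀ (S : Finset α) (f : α → α), S.card = m → CyclesOn f S →
    (∀ v ∈ S, ∀ w ∈ S, v ≠ w → a v ≠ a w ∧ a v ≠ e w ∧ e v ≠ e w) →
    (∀ v ∈ S, ∀ w ∈ S, a v ≠ e v → a w ≠ e w →
      min (a v) (e v) < min (a w) (e w) → max (a v) (e v) < max (a w) (e w)) →
    (∀ v ∈ S, ∀ u ∈ S, NotBetween (a u) (e v) (a (f v)) ∧ NotBetween (e u) (e v) (a (f v))) →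
    |∑ v ∈ S, ((SignType.sign (e v - a v) : SignType) : ℤ)| ≤ 1 := by
  induction m using Nat.strong_induction_on with
  | _ m ih =>
  intro S f hm hf hdist hnest hlink
  have hsign : ∀ v, |((SignType.sign (e v - a v) : SignType) : ℤ)| ≤ 1 := by
    intro v
    rcases SignType.sign (e v - a v) with _ | _ | _ <;> simp
  rcases Nat.lt_or_ge 1 S.card with hcard | hcard
  swap
  · rcases Nat.eq_zero_or_pos S.card with h0 | h0
    · rw [Finset.card_eq_zero.1 h0]; simp
    · obtain ⟨v, rfl⟩ := Finset.card_eq_one.1 (le_antisymm hcard h0)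
      simpa using hsign v
  by_cases hdeg : ∃ v ∈ S, a v = e v
  · obtain ⟨v, hv, hav⟩ := hdeg
    have hlt : (S.erase v).card < m := hm ▸ Finset.card_erase_lt_of_mem hv
    have key := ih _ hlt (S.erase v) (bypass f v) rfl (hf.bypass_erase hcard hv)
      (fun x hx y hy => hdist x (Finset.mem_of_mem_erase hx) y (Finset.mem_of_mem_erase hy))
      (fun x hx y hy => hnest x (Finset.mem_of_mem_erase hx) y (Finset.mem_of_mem_erase hy))
      (by
        intro x hx u hu
        obtain ⟨huv, huS⟩ := Finset.mem_erase.1 hu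
        have hxS := Finset.mem_of_mem_erase hx
        unfold bypass
        split_ifs with hxv
        · have h1 := hlink x hxS u huS
          have h2 := hlink v hv u huS
          have h3 := hdist u huS v hv huv
          rw [hxv] at h1
          obtain ⟨h31, h32, h33⟩ := h3
          simp only [NotBetween] at *
          rw [hav] at *
          constructor
          · rcases h1.1 with h | h <;> rcases h2.1 with h' | h'
            · exact Or.inl ⟨h.1, h'.2⟩
            · exact absurd (le_antisymm h.2 h'.1) h31
            · exact absurd (le_antisymm h'.1 h.2) h31
            · exact Or.inr ⟨h.1, h'.2⟩
          · rcases h1.2 with h | h <;> rcases h2.2 with h' | h'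
            · exact Or.inl ⟨h.1, h'.2⟩
            · exact absurd (le_antisymm h.2 h'.1) h33
            · exact absurd (le_antisymm h'.1 h.2) h33
            · exact Or.inr ⟨h.1, h'.2⟩
        · exact hlink x hxS u huS)
    rw [← Finset.add_sum_erase S _ hv]
    simpa [hav] using key
  · push Not at hdeg
    have hlow : ∃ x ∈ S, e x < a x ∧ a (f x) < e (f x) := by
      obtain ⟨v, hv, hmin⟩ := Finset.exists_min_image S (fun v => min (a v) (e v))
        (Finset.card_pos.1 (Nat.zero_lt_of_lt hcard))
      have hfv := hf.apply_ne_self hcard hv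
      rcases lt_or_gt_of_ne (hdeg v hv) with h | h
      · obtain ⟨z, hz, hzv⟩ := hf.exists_pred hv
        have hzne : z ≠ v := by rintro rfl; exact hfv hzv
        refine ⟨z, hz, ?_, by rwa [hzv]⟩
        have h1 := (hlink z hz z hz).1
        have h2 := hmin z hz
        have h3 := hdist z hz v hv hzne
        have h4 := hdeg z hz
        rw [hzv] at h1
        by_contra hcon
        grind [NotBetween]
      · refine ⟨v, hv, h, ?_⟩
        have hfS := hf.mapsTo v hv
        have h1 := (hlink v hv (f v) hfS).2
        have h2 := hmin (f v) hfS
        have h3 := hdist v hv (f v) hfS hfv.symm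
        have h4 := hdeg (f v) hfS
        by_contra hcon
        grind [NotBetween]
    obtain ⟨x, hx, hmax⟩ := Finset.exists_max_image
      (S.filter fun x => e x < a x ∧ a (f x) < e (f x)) e
      (by obtain ⟨x, h⟩ := hlow; exact ⟨x, by simpa using h⟩)
    obtain ⟨hxS, hxl, hyl⟩ : x ∈ S ∧ e x < a x ∧ a (f x) < e (f x) := by simpa using hx
    have hmax' : ∀ w ∈ S, e w < a w → a (f w) < e (f w) → e w ≤ e x := fun w hw h1 h2 =>
      hmax w (by simp [hw, h1, h2])
    obtain ⟨y, hy⟩ : ∃ y, y = f x := ⟨_, rfl⟩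
    rw [← hy] at hyl
    have hyS : y ∈ S := hy ▸ hf.mapsTo x hxS
    have hyx : y ≠ x := hy ▸ hf.apply_ne_self hcard hxS
    have hyE : y ∈ S.erase x := Finset.mem_erase.2 ⟨hyx, hyS⟩
    have hsum : ∑ v ∈ S, ((SignType.sign (e v - a v) : SignType) : ℤ) =
        ∑ v ∈ (S.erase x).erase y, ((SignType.sign (e v - a v) : SignType) : ℤ) := by
      rw [← Finset.add_sum_erase S _ hxS, ← Finset.add_sum_erase (S.erase x) _ hyE,
        sign_neg (sub_neg.2 hxl), sign_pos (sub_pos.2 hyl)]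
      simp
    rw [hsum]
    have hcE : (S.erase x).card = S.card - 1 := Finset.card_erase_of_mem hxS
    have hcE' : ((S.erase x).erase y).card = S.card - 2 := by
      rw [Finset.card_erase_of_mem hyE, hcE]; omega
    by_cases hfy : f y = x
    · have hS := hf.minimal {x, y} (by simp [Finset.insert_subset_iff, hxS, hyS]) ⟨x, by simp⟩
        (by simp [hfy, ← hy])
      have h2 : S.card = 2 := by rw [← hS, Finset.card_pair hyx.symm]
      have : (S.erase x).erase y = ∅ := Finset.card_eq_zero.1 (by omega)
      rw [this]; simp
    · have h3 : 1 < (S.erase x).card := by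
        by_contra hcon
        have h2 : S.card = 2 := by omega
        have hpair : ({x, y} : Finset α) = S := Finset.eq_of_subset_of_card_le
          (by simp [Finset.insert_subset_iff, hxS, hyS]) (by rw [Finset.card_pair hyx.symm, h2])
        have h4 := hf.mapsTo y hyS
        rw [← hpair] at h4
        rcases Finset.mem_insert.1 h4 with h4 | h4
        · exact hfy h4
        · exact hf.apply_ne_self hcard hyS (Finset.mem_singleton.1 h4)
      have hxy : ∀ u ∈ S, NotBetween (a u) (e x) (a y) ∧ NotBetween (e u) (e x) (a y) := by
        intro u hu
        have := hlink x hxS u hu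
        rwa [← hy] at this
      refine ih _ (by omega) _ (bypass (bypass f x) y) rfl
        ((hf.bypass_erase hcard hxS).bypass_erase h3 hyE)
        (fun v hv w hw => hdist v (Finset.mem_of_mem_erase (Finset.mem_of_mem_erase hv))
          w (Finset.mem_of_mem_erase (Finset.mem_of_mem_erase hw)))
        (fun v hv w hw => hnest v (Finset.mem_of_mem_erase (Finset.mem_of_mem_erase hv))
          w (Finset.mem_of_mem_erase (Finset.mem_of_mem_erase hw))) ?_
      have hhi : ∀ w ∈ S, w ≠ x → w ≠ y →
          NotBetween (max (a w) (e w)) (a x) (e y) := by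
        intro w hw hwx hwy
        have h1 := hnest x hxS w hw (hdeg x hxS) (hdeg w hw)
        have h2 := hnest w hw x hxS (hdeg w hw) (hdeg x hxS)
        have h3 := hnest y hyS w hw (hdeg y hyS) (hdeg w hw)
        have h4 := hnest w hw y hyS (hdeg w hw) (hdeg y hyS)
        have h5 := hxy w hw
        have h6 := hdist w hw x hxS hwx
        have h7 := hdist w hw y hyS hwy
        rw [max_eq_left hxl.le, min_eq_right hxl.le] at h1 h2
        rw [max_eq_right hyl.le, min_eq_left hyl.le] at h3 h4
        have h8 : NotBetween (min (a w) (e w)) (e x) (a y) := by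
          rcases min_choice (a w) (e w) with h | h <;> rw [h]
          exacts [h5.1, h5.2]
        have h9 : min (a w) (e w) ≠ e x := by
          rcases min_choice (a w) (e w) with h | h <;> rw [h]
          exacts [h6.2.1, h6.2.2]
        have h10 : min (a w) (e w) ≠ a y := by
          rcases min_choice (a w) (e w) with h | h <;> rw [h]
          exacts [h7.1, (hdist y hyS w hw hwy.symm).2.1.symm]
        rcases h8 with h | h
        · exact Or.inl ⟨(h2 (lt_of_le_of_ne h.1 h9)).le, (h4 (lt_of_le_of_ne h.2 h10)).le⟩
        · exact Or.inr ⟨(h1 (lt_of_le_of_ne h.1 h9.symm)).le,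
            (h3 (lt_of_le_of_ne h.2 h10.symm)).le⟩
      have hbelow : ∀ q, NotBetween q (e x) (a y) → q ≠ e x → q ≤ e x → q ≤ a x ∧ q ≤ e y := by
        rintro q (h | h) hq hqx
        · exact ⟨h.1.trans hxl.le, h.2.trans hyl.le⟩
        · exact absurd (le_antisymm hqx h.1) hq
      have hlo : ∀ w ∈ S, w ≠ x → w ≠ y → (e w < a w → f w ≠ x) →
          (a w < e w → f y ≠ w) →
          NotBetween (min (a w) (e w)) (a x) (e y) := by
        intro w hw hwx hwy hwz hwu
        have hw5 := hxy w hw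
        have hwdx := hdist w hw x hxS hwx
        have hwdy := hdist w hw y hyS hwy
        rcases lt_or_gt_of_ne (hdeg w hw) with h | h
        · obtain ⟨v, hv, hvw⟩ := hf.exists_pred hw
          have hvx : v ≠ x := by rintro rfl; exact hwy (hvw.symm.trans hy.symm)
          have hvy : v ≠ y := by rintro rfl; exact hwu h hvw
          have hvdx := hdist v hv x hxS hvx
          have hvdy := hdist v hv y hyS hvy
          have lx := hlink v hv x hxS
          have ly := hlink v hv y hyS
          rw [hvw] at lx ly
          rw [min_eq_left h.le]
          rcases lt_or_gt_of_ne (hdeg v hv) with hv' | hv'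
          · have h3 := hhi v hv hvx hvy
            rw [max_eq_right hv'.le] at h3
            exact notBetween_of_adjacent (hdist x hxS v hv hvx.symm).2.1.symm hvdy.2.2 h3 lx.1.swap ly.2.swap
          · have h3 := hmax' v hv hv' (by rwa [hvw])
            have h4 : a w ≤ e x := by
              rcases lx.2 with h4 | h4
              · exact absurd (le_antisymm h3 h4.1) hvdx.2.2
              · exact h4.2
            exact Or.inl (hbelow (a w) hw5.1 hwdx.2.1 h4)
        · obtain ⟨v, hvw⟩ : ∃ v, v = f w := ⟨_, rfl⟩
          have hv : v ∈ S := hvw ▸ hf.mapsTo w hw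
          have hvx : v ≠ x := by rw [hvw]; exact hwz h
          have hvy : v ≠ y := by
            rintro rfl; exact hwx (hf.injOn w hw x hxS (hvw.symm.trans hy))
          have hvdx := hdist v hv x hxS hvx
          have hvdy := hdist v hv y hyS hvy
          have lx := hlink w hw x hxS
          have ly := hlink w hw y hyS
          rw [← hvw] at lx ly
          rw [min_eq_right h.le]
          rcases lt_or_gt_of_ne (hdeg v hv) with hv' | hv'
          · have h3 := hmax' w hw h (by rwa [← hvw])
            exact Or.inl (hbelow (e w) hw5.2 hwdx.2.2 h3)
          · have h3 := hhi v hv hvx hvy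
            rw [max_eq_left hv'.le] at h3
            exact notBetween_of_adjacent hvdx.1 hvdy.2.1 h3 lx.1 ly.2
      intro z hz u hu
      obtain ⟨hzy, hz'⟩ := Finset.mem_erase.1 hz
      obtain ⟨hzx, hzS⟩ := Finset.mem_erase.1 hz'
      obtain ⟨huy, hu'⟩ := Finset.mem_erase.1 hu
      obtain ⟨hux, huS⟩ := Finset.mem_erase.1 hu'
      have hfzy : f z ≠ y := fun h => hzx (hf.injOn z hzS x hxS (h.trans hy))
      by_cases hfz : f z = x
      · have hb : bypass (bypass f x) y z = f y := by
          simp [bypass, hfz, hfy, ← hy]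
        rw [hb]
        have lz := hlink z hzS u huS
        have ly := hlink y hyS u huS
        rw [hfz] at lz
        have hdx := hdist u huS x hxS hux
        have hdy := hdist u huS y hyS huy
        have hdx' := hdist x hxS u huS hux.symm
        have h1 := hhi u huS hux huy
        have h2 := hlo u huS hux huy
        rcases lt_or_gt_of_ne (hdeg u huS) with h | h
        · rw [max_eq_right h.le] at h1
          rw [min_eq_left h.le] at h2
          refine ⟨?_, NotBetween.trans hdx'.2.1.symm hdy.2.2 lz.2 h1 ly.2⟩
          by_cases hu : f y = u
          · rw [hu]
            exact (notBetween_left (a u) (e z)).swap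
          · exact NotBetween.trans hdx.1 hdy.2.1 lz.1 (h2 (fun h' => absurd h h'.not_gt) fun _ => hu) ly.1
        · rw [max_eq_left h.le] at h1
          rw [min_eq_right h.le] at h2
          refine ⟨NotBetween.trans hdx.1 hdy.2.1 lz.1 h1 ly.1, ?_⟩
          by_cases hu : f u = x
          · obtain rfl := hf.injOn u huS z hzS (hu.trans hfz.symm)
            exact notBetween_left _ _
          · exact NotBetween.trans hdx'.2.1.symm hdy.2.2 lz.2
              (h2 (fun _ => hu) fun h' => absurd h h'.not_gt) ly.2
      · have hb : bypass (bypass f x) y z = f z := by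
          simp [bypass, hfz, hfzy]
        rw [hb]
        exact hlink z hzS u huS

/-- Cost of supplier `i`, upgraded or not according to `s`. -/
def levelCost {n : ℕ} (b c : Fin n → ℝ) (i : Fin n) (s : Prop) [Decidable s] : ℝ :=
  if s then b i else c i

/-- The point with a single unit entry at `(i, j)`, in the first matrix if `s` holds and in the
second one otherwise. -/
def unitPoint {n : ℕ} (i j : Fin n) (s : Prop) [Decidable s] :
    (Fin n → Fin n → ℝ) × (Fin n → Fin n → ℝ) :=
  (fun i' j' => if i' = i ∧ j' = j ∧ s then 1 else 0,
   fun i' j' => if i' = i ∧ j' = j ∧ ¬ s then 1 else 0)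

section UnitPoint

variable {n : ℕ} (i j : Fin n) (s : Prop) [Decidable s]

theorem unitPoint_nonneg : 0 ≤ unitPoint i j s := by
  constructor <;> intro i' j' <;> simp only [unitPoint] <;> split_ifs <;> simp

theorem obj_unitPoint (b c d : Fin n → ℝ) :
    obj b c d (unitPoint i j s) = levelCost b c i s * d j := by
  by_cases hs : s <;> simp [obj, unitPoint, levelCost, hs, ite_and]

theorem sum_fst_unitPoint : ∑ i', ∑ j', (unitPoint i j s).1 i' j' = if s then 1 else 0 := by
  by_cases hs : s <;> simp [unitPoint, hs, ite_and]

theorem sum_col_unitPoint (j' : Fin n) :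
    ∑ i', ((unitPoint i j s).1 i' j' + (unitPoint i j s).2 i' j') = if j' = j then 1 else 0 := by
  by_cases hs : s <;> simp [unitPoint, hs, ite_and]

theorem sum_row_unitPoint (i' : Fin n) :
    ∑ j', ((unitPoint i j s).1 i' j' + (unitPoint i j s).2 i' j') = if i' = i then 1 else 0 := by
  by_cases hs : s <;> simp [unitPoint, hs, ite_and]

theorem unitPoint_le_chi (π : Equiv.Perm (Fin n)) (A : Finset (Fin n)) (v : Fin n)
    {s : Prop} [Decidable s] (hs : s ↔ v ∈ A) :
    unitPoint v (π.symm v) s ≤ chi π A := by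
  constructor <;> intro i' j' <;> simp only [unitPoint, chi] <;> split_ifs with h1 h2 <;>
    first | exact le_rfl | exact zero_le_one | skip
  all_goals
    obtain ⟨rfl, rfl, h⟩ := h1
    exact absurd ⟨by simp, by simpa [hs] using h⟩ h2

theorem chi_nonneg (π : Equiv.Perm (Fin n)) (A : Finset (Fin n)) : 0 ≤ chi π A := by
  constructor <;> intro i' j' <;> simp only [chi] <;> split_ifs <;> simp

end UnitPoint

/-- Exchanging the customers of two entries in the support of an optimal point, possibly
redistributing the upgrades among them, does not decrease the cost. -/
theorem levelCost_exchange {n k : ℕ} {b c d : Fin n → ℝ}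
    {z : (Fin n → Fin n → ℝ) × (Fin n → Fin n → ℝ)} (hz : z ∈ Pk n k)
    (hopt : ∀ p ∈ Pk n k, obj b c d z ≤ obj b c d p) {ε : ℝ} (hε : 0 < ε)
    (i i' j j' : Fin n) (s s' t t' : Prop) [Decidable s] [Decidable s'] [Decidable t] [Decidable t']
    (hcount : (if t then (1 : ℝ) else 0) + (if t' then 1 else 0) =
      (if s then 1 else 0) + (if s' then 1 else 0))
    (hle : ε • (unitPoint i j s + unitPoint i' j' s') ≤ z) :
    levelCost b c i s * d j + levelCost b c i' s' * d j' ≤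
      levelCost b c i' t * d j + levelCost b c i t' * d j' := by
  obtain ⟨h1, h2, h3, h4, h5⟩ := hz
  set p := z + ε • (unitPoint i' j t + unitPoint i j' t' - (unitPoint i j s + unitPoint i' j' s'))
    with hp
  have hp1 : ∀ x y, p.1 x y = z.1 x y + ε * ((unitPoint i' j t).1 x y + (unitPoint i j' t').1 x y
      - ((unitPoint i j s).1 x y + (unitPoint i' j' s').1 x y)) := fun x y => rfl
  have hp2 : ∀ x y, p.2 x y = z.2 x y + ε * ((unitPoint i' j t).2 x y + (unitPoint i j' t').2 x y
      - ((unitPoint i j s).2 x y + (unitPoint i' j' s').2 x y)) := fun x y => rfl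
  have hmem : p ∈ Pk n k := by
    refine ⟨fun x y => ?_, fun x y => ?_, fun y => ?_, fun x => ?_, ?_⟩
    · have e1 := hle.1 x y
      have e2 := mul_nonneg hε.le ((unitPoint_nonneg i' j t).1 x y)
      have e3 := mul_nonneg hε.le ((unitPoint_nonneg i j' t').1 x y)
      simp only [Prod.smul_fst, Prod.fst_add, Pi.smul_apply, Pi.add_apply, smul_eq_mul] at e1
      rw [hp1]
      linarith
    · have e1 := hle.2 x y
      have e2 := mul_nonneg hε.le ((unitPoint_nonneg i' j t).2 x y)
      have e3 := mul_nonneg hε.le ((unitPoint_nonneg i j' t').2 x y)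
      simp only [Prod.smul_snd, Prod.snd_add, Pi.smul_apply, Pi.add_apply, smul_eq_mul] at e1
      rw [hp2]
      linarith
    · have e : ∑ x, (p.1 x y + p.2 x y) = ∑ x, (z.1 x y + z.2 x y) +
          ε * (∑ x, ((unitPoint i' j t).1 x y + (unitPoint i' j t).2 x y) +
            ∑ x, ((unitPoint i j' t').1 x y + (unitPoint i j' t').2 x y) -
            (∑ x, ((unitPoint i j s).1 x y + (unitPoint i j s).2 x y) +
            ∑ x, ((unitPoint i' j' s').1 x y + (unitPoint i' j' s').2 x y))) := by
        simp only [← Finset.sum_add_distrib, ← Finset.sum_sub_distrib, Finset.mul_sum, hp1, hp2]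
        exact Finset.sum_congr rfl fun x _ => by ring
      rw [e, h3]
      simp only [sum_col_unitPoint]
      ring
    · have e : ∑ y, (p.1 x y + p.2 x y) = ∑ y, (z.1 x y + z.2 x y) +
          ε * (∑ y, ((unitPoint i' j t).1 x y + (unitPoint i' j t).2 x y) +
            ∑ y, ((unitPoint i j' t').1 x y + (unitPoint i j' t').2 x y) -
            (∑ y, ((unitPoint i j s).1 x y + (unitPoint i j s).2 x y) +
            ∑ y, ((unitPoint i' j' s').1 x y + (unitPoint i' j' s').2 x y))) := by
        simp only [← Finset.sum_add_distrib, ← Finset.sum_sub_distrib, Finset.mul_sum, hp1, hp2]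
        exact Finset.sum_congr rfl fun x _ => by ring
      rw [e, h4]
      simp only [sum_row_unitPoint]
      ring
    · have e : ∑ x, ∑ y, p.1 x y = ∑ x, ∑ y, z.1 x y +
          ε * (∑ x, ∑ y, (unitPoint i' j t).1 x y + ∑ x, ∑ y, (unitPoint i j' t').1 x y -
            (∑ x, ∑ y, (unitPoint i j s).1 x y + ∑ x, ∑ y, (unitPoint i' j' s').1 x y)) := by
        simp only [← Finset.sum_add_distrib, ← Finset.sum_sub_distrib, Finset.mul_sum, hp1]
      rw [e]
      simp only [sum_fst_unitPoint]
      rw [hcount, sub_self, mul_zero, add_zero]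
      exact h5
  have hobj : obj b c d p = obj b c d z + ε * (obj b c d (unitPoint i' j t) +
      obj b c d (unitPoint i j' t') - (obj b c d (unitPoint i j s) +
        obj b c d (unitPoint i' j' s'))) := by
    simp only [obj, ← Finset.sum_add_distrib, ← Finset.sum_sub_distrib, Finset.mul_sum, hp1, hp2]
    exact Finset.sum_congr rfl fun x _ => Finset.sum_congr rfl fun y _ => by ring
  have hfin := hopt p hmem
  rw [hobj] at hfin
  have hfin' := nonneg_of_mul_nonneg_right (le_add_iff_nonneg_right _ |>.1 hfin) hε
  simp only [obj_unitPoint] at hfin'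
  linarith

theorem cyclesOn_sameCycle {α : Type*} [Fintype α] [DecidableEq α] (σ : Equiv.Perm α) (v₀ : α) :
    CyclesOn σ (univ.filter fun v => σ.SameCycle v₀ v) := by
  refine ⟨fun v hv => ?_, fun v _ w _ h => σ.injective h, fun T hT ⟨t, ht⟩ hTσ => ?_⟩
  · simpa using hv
  · refine hT.antisymm fun s hs => ?_
    have h1 : σ.SameCycle v₀ t := by simpa using hT ht
    have h2 : σ.SameCycle v₀ s := by simpa using hs
    obtain ⟨m, -, rfl⟩ := (h1.symm.trans h2).exists_pow_eq'
    clear hs h2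
    induction m with
    | zero => simpa using ht
    | succ m ih => rw [pow_succ', Equiv.Perm.mul_apply]; exact hTσ _ ih

/-- with pairwise distinct costs and demands, any optimal
fractional convex combination of two optimal matchings has, on each cycle,
numbers of upgraded suppliers from `A` and `B` differing by at most 1. -/
theorem stmt18 (n : ℕ) (hn : 1 ≤ n) (b c d : Fin n → ℝ)
    (hb : ∀ i, 0 ≤ b i) (hbc : ∀ i, b i ≤ c i) (hd : ∀ j, 0 ≤ d j)
    (hbc_distinct : Function.Injective (Sum.elim b c))
    (hd_distinct : Function.Injective d) (k : ℕ)
    (lam : ℝ) (hlam0 : 0 < lam) (hlam1 : lam < 1)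
    (A B : Finset (Fin n)) (hA : A.card < k) (hB : k < B.card)
    (πA πB : Equiv.Perm (Fin n))
    (hπA : assignCost b c d A πA = cost b c d A)
    (hπB : assignCost b c d B πB = cost b c d B)
    (hmem : lam • chi πA A + (1 - lam) • chi πB B ∈ Pk n k)
    (hopt : ∀ p ∈ Pk n k,
      obj b c d (lam • chi πA A + (1 - lam) • chi πB B) ≤ obj b c d p)
    (σ : Equiv.Perm (Fin n)) (hσ : σ = πB.symm.trans πA)
    (O : Set (Fin n)) (v₀ : Fin n) (hO : O = {v | σ.SameCycle v₀ v}) :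
    |(((A : Set (Fin n)) ∩ O).ncard : ℤ) -
      (((B : Set (Fin n)) ∩ O).ncard : ℤ)| ≤ 1 := by
  classical
  obtain ⟨ε, hε, hεA, hεB⟩ : ∃ ε : ℝ, 0 < ε ∧ 2 * ε ≤ lam ∧ 2 * ε ≤ 1 - lam := by
    refine ⟨min lam (1 - lam) / 2, ?_, ?_, ?_⟩
    · have : 0 < min lam (1 - lam) := lt_min hlam0 (by linarith)
      linarith
    · linarith [min_le_left lam (1 - lam)]
    · linarith [min_le_right lam (1 - lam)]
  have hlt : ∀ i, b i < c i := fun i =>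
    lt_of_le_of_ne (hbc i) fun h => by
      have := @hbc_distinct (Sum.inl i) (Sum.inr i) h
      simp at this
  have hlev : ∀ v w : Fin n, v ≠ w → ∀ (s t : Prop) [Decidable s] [Decidable t],
      levelCost b c v s ≠ levelCost b c w t := by
    intro v w hvw s t _ _ h
    have hval : ∀ (v : Fin n) (s : Prop) [Decidable s], ∃ x, Sum.elim b c x = levelCost b c v s ∧
        (x = Sum.inl v ∨ x = Sum.inr v) := by
      intro v s _
      by_cases hs : s
      · exact ⟨Sum.inl v, by simp [levelCost, hs]⟩
      · exact ⟨Sum.inr v, by simp [levelCost, hs]⟩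
    obtain ⟨x, hx, hx'⟩ := hval v s
    obtain ⟨y, hy, hy'⟩ := hval w t
    have hxy : x = y := hbc_distinct (hx.trans (h.trans hy.symm))
    rcases hx' with rfl | rfl <;> rcases hy' with rfl | rfl <;> simp_all
  -- the entries of the optimal point, indexed by supplier and side
  let pos : Fin n → Bool → Fin n := fun v β => if β then πA.symm v else πB.symm v
  let up : Fin n → Bool → Prop := fun v β => if β then v ∈ A else v ∈ B
  have hsupp : ∀ v β, unitPoint v (pos v β) (up v β) ≤ chi πA A + chi πB B := by
    intro v β
    cases β
    · exact (unitPoint_le_chi πB B v (by simp [up])).trans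
        (le_add_of_nonneg_left (chi_nonneg πA A))
    · exact (unitPoint_le_chi πA A v (by simp [up])).trans
        (le_add_of_nonneg_right (chi_nonneg πB B))
  have hdom : ε • ((chi πA A + chi πB B) + (chi πA A + chi πB B)) ≤
      lam • chi πA A + (1 - lam) • chi πB B := by
    have e : ε • ((chi πA A + chi πB B) + (chi πA A + chi πB B)) =
        (2 * ε) • chi πA A + (2 * ε) • chi πB B := by module
    rw [e]
    exact add_le_add (smul_le_smul_of_nonneg_right hεA (chi_nonneg _ _))
      (smul_le_smul_of_nonneg_right hεB (chi_nonneg _ _))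
  have hex : ∀ (v w : Fin n) (β γ : Bool) (t t' : Prop) [Decidable t] [Decidable t'],
      ((if t then (1 : ℝ) else 0) + (if t' then 1 else 0) =
        (if up v β then 1 else 0) + (if up w γ then 1 else 0)) →
      levelCost b c v (up v β) * d (pos v β) + levelCost b c w (up w γ) * d (pos w γ) ≤
      levelCost b c w t * d (pos v β) + levelCost b c v t' * d (pos w γ) := by
    intro v w β γ t t' _ _ hc
    exact levelCost_exchange hmem hopt hε v w _ _ _ _ t t' hc
      ((smul_le_smul_of_nonneg_left (add_le_add (hsupp v β) (hsupp w γ)) hε.le).trans hdom)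
  -- labels are antitone in the demand
  have hmono : ∀ v w β γ, d (pos v β) < d (pos w γ) →
      levelCost b c w (up w γ) ≤ levelCost b c v (up v β) := by
    intro v w β γ h
    have := hex v w β γ (up w γ) (up v β) (add_comm _ _)
    by_contra hcon
    push Not at hcon
    nlinarith [mul_pos (sub_pos.2 hcon) (sub_pos.2 h)]
  set S : Finset (Fin n) := univ.filter fun v => σ.SameCycle v₀ v with hS
  have hcyc : CyclesOn σ S := cyclesOn_sameCycle σ v₀
  let a : Fin n → ℝ := fun v => levelCost b c v (up v true)
  let e : Fin n → ℝ := fun v => levelCost b c v (up v false)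
  have hcases : ∀ v, a v ≠ e v → ∃ β, ¬ up v β ∧ up v (!β) ∧
      min (a v) (e v) = b v ∧ max (a v) (e v) = c v := by
    intro v hv
    by_cases h1 : v ∈ A <;> by_cases h2 : v ∈ B
    · simp [a, e, levelCost, up, h1, h2] at hv
    · exact ⟨false, by simp [up, h2], by simp [up, h1],
        by simp [a, e, levelCost, up, h1, h2, hbc], by simp [a, e, levelCost, up, h1, h2, hbc]⟩
    · exact ⟨true, by simp [up, h1], by simp [up, h2],
        by simp [a, e, levelCost, up, h1, h2, hbc], by simp [a, e, levelCost, up, h1, h2, hbc]⟩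
    · simp [a, e, levelCost, up, h1, h2] at hv
  have hmain := abs_sum_sign_le_one a e S.card S σ rfl hcyc
    (fun v _ w _ hvw => ⟨hlev v w hvw _ _, hlev v w hvw _ _, hlev v w hvw _ _⟩)
    (by
      intro v hv w hw hav haw hmin
      obtain ⟨β, hβ, hβ', hminv, hmaxv⟩ := hcases v hav
      obtain ⟨γ, hγ, hγ', hminw, hmaxw⟩ := hcases w haw
      rw [hminv, hminw] at hmin
      rw [hmaxv, hmaxw]
      have hvw : v ≠ w := by rintro rfl; exact lt_irrefl _ hmin
      by_contra hcon
      have hcw : c w < c v := by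
        refine lt_of_le_of_ne (not_lt.1 hcon) fun h => ?_
        have := @hbc_distinct (Sum.inr w) (Sum.inr v) h
        exact hvw (Sum.inr.inj this).symm
      have hpos : pos w γ ≠ pos w (!γ) := by
        intro h
        have hAB : πA.symm w = πB.symm w := by cases γ <;> simpa [pos, eq_comm] using h
        have hfix : σ w = w := by
          rw [hσ, Equiv.trans_apply, ← hAB, Equiv.apply_symm_apply]
        have h1 : σ.SameCycle v w :=
          ((Finset.mem_filter.1 hv).2.symm).trans (Finset.mem_filter.1 hw).2
        exact hvw (h1.eq_of_right hfix)
      have hdpos : 0 < d (pos w (!γ)) := by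
        refine lt_of_le_of_ne (hd _) fun h0 => ?_
        have h1 : d (pos w (!γ)) < d (pos w γ) :=
          lt_of_le_of_ne (h0 ▸ hd _) fun h => hpos (hd_distinct h).symm
        have h2 := hmono _ _ _ _ h1
        rw [levelCost, levelCost, if_neg hγ, if_pos hγ'] at h2
        exact absurd (hlt w) h2.not_gt
      have h := hex v w β (!γ) False True (by simp [hβ, hγ'])
      simp only [levelCost, if_neg hβ, if_pos hγ', if_true, if_false] at h
      nlinarith [mul_nonneg (sub_pos.2 hcw).le (hd (pos v β)), mul_pos (sub_pos.2 hmin) hdpos])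
    (by
      have hnb : ∀ v u γ, NotBetween (levelCost b c u (up u γ)) (e v) (a (σ v)) := by
        intro v u γ
        have hσv : pos (σ v) true = pos v false := by simp [pos, hσ]
        by_cases hj : pos u γ = pos v false
        · cases γ
          · have : u = v := by simpa [pos] using hj
            subst this
            exact notBetween_left _ _
          · have : u = σ v := by
              rw [← hσv] at hj
              simpa [pos] using hj
            subst this
            exact (notBetween_left _ _).swap
        · rcases lt_or_gt_of_ne (fun h => hj (hd_distinct h)) with h | h
          · exact Or.inr ⟨hmono _ _ _ _ h, hmono _ _ _ _ (hσv ▸ h)⟩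
          · exact Or.inl ⟨hmono _ _ _ _ h, hmono _ _ _ _ (hσv ▸ h)⟩
      exact fun v _ u _ => ⟨hnb v u true, hnb v u false⟩)
  have hcard : ∀ X : Finset (Fin n), (((X : Set (Fin n)) ∩ O).ncard : ℤ) =
      ∑ v ∈ S, if v ∈ X then 1 else 0 := by
    intro X
    have : (X : Set (Fin n)) ∩ O = ((S.filter fun v => v ∈ X : Finset (Fin n)) : Set (Fin n)) := by
      ext v
      simp [hO, hS, and_comm]
    rw [this, Set.ncard_coe_finset, Finset.card_filter]
    push_cast
    rfl
  rw [hcard, hcard, ← Finset.sum_sub_distrib]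
  convert hmain using 3 with v
  have := hlt v
  by_cases h1 : v ∈ A <;> by_cases h2 : v ∈ B <;>
    simp [a, e, levelCost, up, h1, h2, this]
end
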